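/- arXiv:2604.15386 — 12 statements merged into one kernel-verified Lean document; each statement's English description precedes it below -/
import Mathlib

section
/- The special linear group SL(2, ℤ[i]) is generated as a group by the four matrices A = !![0, -1; 1, 0], T = !![1, 1; 0, 1], U = !![1, i; 0, 1], and L = !![i, 0; 0, -i]; that is, the subgroup closure of {A, T, U, L} in SL(2, ℤ[i]) is the whole group. -/
open Matrix

/-- The generator `A = !![0, -1; 1, 0]` of `SL(2, ℤ[i])`. -/
def Agen : Matrix.SpecialLinearGroup (Fin 2) GaussianInt :=
  ⟨!![0, -1; 1, 0], by simp [Matrix.det_fin_two_of]⟩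

/-- The generator `T = !![1, 1; 0, 1]` of `SL(2, ℤ[i])`. -/
def Tgen : Matrix.SpecialLinearGroup (Fin 2) GaussianInt :=
  ⟨!![1, 1; 0, 1], by simp [Matrix.det_fin_two_of]⟩

/-- The generator `U = !![1, i; 0, 1]` of `SL(2, ℤ[i])`. -/
def Ugen : Matrix.SpecialLinearGroup (Fin 2) GaussianInt :=
  ⟨!![1, Zsqrtd.sqrtd; 0, 1], by simp [Matrix.det_fin_two_of]⟩

/-- The generator `L = !![i, 0; 0, -i]` of `SL(2, ℤ[i])`. -/
def Lgen : Matrix.SpecialLinearGroup (Fin 2) GaussianInt :=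
  ⟨!![Zsqrtd.sqrtd, 0; 0, -Zsqrtd.sqrtd], by
    simp [Matrix.det_fin_two_of, Zsqrtd.ext_iff]⟩

/-- The homomorphism sending `x` to the upper unitriangular matrix `!![1, x; 0, 1]`. -/
def upperUnitriangular {R : Type*} [CommRing R] :
    Multiplicative R →* Matrix.SpecialLinearGroup (Fin 2) R where
  toFun x := ⟨!![1, x.toAdd; 0, 1], by simp [Matrix.det_fin_two_of]⟩
  map_one' := by
    ext i j
    fin_cases i <;> fin_cases j <;> simp
  map_mul' x y := by
    apply Subtype.ext
    change !![1, x.toAdd + y.toAdd; 0, 1] = !![1, x.toAdd; 0, 1] * !![1, y.toAdd; 0, 1]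
    simp [add_comm]

theorem coe_upperUnitriangular {R : Type*} [CommRing R] (x : R) :
    (upperUnitriangular (.ofAdd x) : Matrix (Fin 2) (Fin 2) R) = !![1, x; 0, 1] := rfl

theorem upperUnitriangular_mem_closure (x : GaussianInt) :
    upperUnitriangular (.ofAdd x) ∈ Subgroup.closure {Agen, Tgen, Ugen, Lgen} := by
  have hx : x = x.re • (1 : GaussianInt) + x.im • Zsqrtd.sqrtd := by
    simp [Zsqrtd.ext_iff]
  have hT : upperUnitriangular (.ofAdd (1 : GaussianInt)) = Tgen := rfl
  have hU : upperUnitriangular (.ofAdd (Zsqrtd.sqrtd : GaussianInt)) = Ugen := rfl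
  rw [hx, ofAdd_add, map_mul, ofAdd_zsmul, ofAdd_zsmul, map_zpow, map_zpow, hT, hU]
  exact mul_mem (zpow_mem (Subgroup.subset_closure (by simp)) _)
    (zpow_mem (Subgroup.subset_closure (by simp)) _)

theorem GaussianInt.exists_eq_sqrtd_pow_of_isUnit {a : GaussianInt} (ha : IsUnit a) :
    ∃ k : ℕ, a = Zsqrtd.sqrtd ^ k := by
  have h : a.re * a.re + a.im * a.im = 1 := by
    have := (Zsqrtd.norm_eq_one_iff' (by norm_num) a).2 ha
    rw [Zsqrtd.norm_def] at this
    linarith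
  have h1 : a.re ≤ 1 := by nlinarith
  have h2 : -1 ≤ a.re := by nlinarith
  obtain ⟨x, y⟩ := a
  simp only at h h1 h2
  have h3 : y ≤ 1 := by nlinarith
  have h4 : -1 ≤ y := by nlinarith
  interval_cases x <;> interval_cases y <;> simp at h
  · exact ⟨2, by decide⟩
  · exact ⟨3, by decide⟩
  · exact ⟨1, by decide⟩
  · exact ⟨0, by decide⟩

theorem coe_Lgen_pow (k : ℕ) :
    ((Lgen ^ k : Matrix.SpecialLinearGroup (Fin 2) GaussianInt) :
      Matrix (Fin 2) (Fin 2) GaussianInt) =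
      !![Zsqrtd.sqrtd ^ k, 0; 0, (-Zsqrtd.sqrtd) ^ k] := by
  induction k with
  | zero => simp [Matrix.one_fin_two]
  | succ k ih => rw [pow_succ, Matrix.SpecialLinearGroup.coe_mul, ih]; simp [Lgen, pow_succ]

theorem mem_closure_of_lower_left_eq_zero {g : Matrix.SpecialLinearGroup (Fin 2) GaussianInt}
    (hg : g 1 0 = 0) : g ∈ Subgroup.closure {Agen, Tgen, Ugen, Lgen} := by
  have hdet : g 0 0 * g 1 1 = 1 := by
    have := g.det_coe
    rwa [Matrix.det_fin_two, hg, mul_zero, sub_zero] at this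
  obtain ⟨k, hk⟩ := GaussianInt.exists_eq_sqrtd_pow_of_isUnit (IsUnit.of_mul_eq_one _ hdet)
  have hI : (Zsqrtd.sqrtd : GaussianInt) ^ k * (-Zsqrtd.sqrtd) ^ k = 1 := by
    rw [← mul_pow, show (Zsqrtd.sqrtd * -Zsqrtd.sqrtd : GaussianInt) = 1 by decide, one_pow]
  have hd : g 1 1 = (-Zsqrtd.sqrtd) ^ k := by
    rw [hk] at hdet
    linear_combination (-Zsqrtd.sqrtd) ^ k * hdet - g 1 1 * hI
  have : g = Lgen ^ k * upperUnitriangular (.ofAdd ((-Zsqrtd.sqrtd) ^ k * g 0 1)) := by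
    apply Subtype.ext
    rw [Matrix.SpecialLinearGroup.coe_mul, coe_Lgen_pow, coe_upperUnitriangular,
      Matrix.eta_fin_two (g : Matrix (Fin 2) (Fin 2) GaussianInt), hg, hk, hd]
    simp [← mul_assoc, hI]
  rw [this]
  exact mul_mem (pow_mem (Subgroup.subset_closure (by simp)) _)
    (upperUnitriangular_mem_closure _)

/-- One step of the Euclidean algorithm on the first column. -/
theorem Agen_mul_upperUnitriangular_mul_lower_left
    (q : GaussianInt) (g : Matrix.SpecialLinearGroup (Fin 2) GaussianInt) :
    (Agen * upperUnitriangular (.ofAdd (-q)) * g) 1 0 = g 0 0 - q * g 1 0 := by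
  have hA : (Agen : Matrix (Fin 2) (Fin 2) GaussianInt) = !![0, -1; 1, 0] := rfl
  rw [Matrix.SpecialLinearGroup.coe_mul, Matrix.SpecialLinearGroup.coe_mul, hA,
    coe_upperUnitriangular]
  simp [Matrix.mul_apply, Fin.sum_univ_two, sub_eq_add_neg]

theorem stmt_4 :
    Subgroup.closure {Agen, Tgen, Ugen, Lgen} =
      (⊤ : Subgroup (Matrix.SpecialLinearGroup (Fin 2) GaussianInt)) := by
  rw [eq_top_iff]
  rintro g -
  induction hn : (g 1 0).norm.natAbs using Nat.strong_induction_on generalizing g with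
  | _ n ih =>
    by_cases hc : g 1 0 = 0
    · exact mem_closure_of_lower_left_eq_zero hc
    · set h := Agen * upperUnitriangular (.ofAdd (-(g 0 0 / g 1 0)))
      have hmem : h ∈ Subgroup.closure {Agen, Tgen, Ugen, Lgen} :=
        mul_mem (Subgroup.subset_closure (by simp)) (upperUnitriangular_mem_closure _)
      refine (Subgroup.mul_mem_cancel_left _ hmem).1 (ih _ ?_ rfl)
      rw [Agen_mul_upperUnitriangular_mul_lower_left, mul_comm, ← GaussianInt.mod_def, ← hn]
      exact GaussianInt.natAbs_norm_mod_lt _ hc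
end

section
/- The special linear group SL(2, ℤ[√-2]) is generated as a group by the three matrices A = !![0, -1; 1, 0], T = !![1, 1; 0, 1], and U = !![1, √-2; 0, 1]; that is, the subgroup closure of {A, T, U} in SL(2, ℤ[√-2]) is the whole group. -/
open Matrix

/-- The generator `A = !![0, -1; 1, 0]` of `SL(2, ℤ[√-2])`. -/
def Agen2 : Matrix.SpecialLinearGroup (Fin 2) (Zsqrtd (-2)) :=
  ⟨!![0, -1; 1, 0], by simp [Matrix.det_fin_two_of]⟩

/-- The generator `T = !![1, 1; 0, 1]` of `SL(2, ℤ[√-2])`. -/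
def Tgen2 : Matrix.SpecialLinearGroup (Fin 2) (Zsqrtd (-2)) :=
  ⟨!![1, 1; 0, 1], by simp [Matrix.det_fin_two_of]⟩

/-- The generator `U = !![1, √-2; 0, 1]` of `SL(2, ℤ[√-2])`. -/
def Ugen2 : Matrix.SpecialLinearGroup (Fin 2) (Zsqrtd (-2)) :=
  ⟨!![1, Zsqrtd.sqrtd; 0, 1], by simp [Matrix.det_fin_two_of]⟩

theorem Int.exists_two_mul_abs_sub_mul_le (x : ℤ) {n : ℤ} (hn : 0 < n) :
    ∃ q : ℤ, 2 * |x - q * n| ≤ n := by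
  refine ⟨(2 * x + n) / (2 * n), ?_⟩
  have h₁ := Int.emod_add_mul_ediv (2 * x + n) (2 * n)
  have h₂ := Int.emod_nonneg (2 * x + n) (b := 2 * n) (by lia)
  have h₃ := Int.emod_lt_of_pos (2 * x + n) (b := 2 * n) (by lia)
  have h₄ : 2 * |x - (2 * x + n) / (2 * n) * n| = |2 * (x - (2 * x + n) / (2 * n) * n)| := by
    rw [abs_mul, abs_two]
  rw [h₄, abs_le]
  constructor <;> linarith

/-- Euclidean division in `ℤ[√-2]`. -/
theorem Zsqrtd.exists_norm_sub_mul_lt (a : Zsqrtd (-2)) {c : Zsqrtd (-2)} (hc : c ≠ 0) :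
    ∃ q : Zsqrtd (-2), (a - q * c).norm < c.norm := by
  have hn : 0 < c.norm := (Zsqrtd.norm_nonneg (by norm_num) c).lt_of_ne'
    (mt (Zsqrtd.norm_eq_zero_iff (by norm_num) c).1 hc)
  obtain ⟨u, hu⟩ := Int.exists_two_mul_abs_sub_mul_le (a * star c).re hn
  obtain ⟨v, hv⟩ := Int.exists_two_mul_abs_sub_mul_le (a * star c).im hn
  refine ⟨⟨u, v⟩, ?_⟩
  set r := (a * star c).re - u * c.norm with hr
  set s := (a * star c).im - v * c.norm with hs
  have key : (a - ⟨u, v⟩ * c).norm * c.norm = r ^ 2 + 2 * s ^ 2 := by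
    rw [hr, hs]
    simp only [Zsqrtd.norm_def, Zsqrtd.re_sub, Zsqrtd.im_sub, Zsqrtd.re_mul, Zsqrtd.im_mul,
      Zsqrtd.re_star, Zsqrtd.im_star]
    ring
  have hr2 : 4 * r ^ 2 ≤ c.norm ^ 2 := by
    rw [← sq_abs r]; nlinarith [abs_nonneg r]
  have hs2 : 4 * s ^ 2 ≤ c.norm ^ 2 := by
    rw [← sq_abs s]; nlinarith [abs_nonneg s]
  nlinarith

theorem Zsqrtd.eq_one_or_eq_neg_one_of_isUnit {a : Zsqrtd (-2)} (ha : IsUnit a) :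
    a = 1 ∨ a = -1 := by
  have h := (Zsqrtd.norm_eq_one_iff' (by norm_num) a).2 ha
  rw [Zsqrtd.norm_def] at h
  have him : a.im = 0 := by
    by_contra h0
    have : 0 < a.im ^ 2 := by positivity
    nlinarith [sq_nonneg a.re]
  rw [him] at h
  have hre : a.re = 1 ∨ a.re = -1 := mul_self_eq_one_iff.1 (by simpa using h)
  rcases hre with h1 | h1
  · left; ext <;> simp [h1, him]
  · right; ext <;> simp [h1, him]

namespace Matrix.SpecialLinearGroup

variable {R : Type*} [CommRing R]

/-- The homomorphism `x ↦ !![1, x; 0, 1]`. -/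
def upperUnipotent : Multiplicative R →* SpecialLinearGroup (Fin 2) R where
  toFun x := ⟨!![1, x.toAdd; 0, 1], by simp [Matrix.det_fin_two_of]⟩
  map_one' := by
    ext i j; fin_cases i <;> fin_cases j <;> simp
  map_mul' x y := by
    apply Subtype.ext
    change !![1, x.toAdd + y.toAdd; 0, 1] = !![1, x.toAdd; 0, 1] * !![1, y.toAdd; 0, 1]
    simp [add_comm]

theorem coe_upperUnipotent (x : R) :
    (upperUnipotent (Multiplicative.ofAdd x) : Matrix (Fin 2) (Fin 2) R) = !![1, x; 0, 1] :=
  rfl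

end Matrix.SpecialLinearGroup

open Matrix.SpecialLinearGroup Multiplicative

theorem upperUnipotent_mem_closure (z : Zsqrtd (-2)) :
    upperUnipotent (ofAdd z) ∈ Subgroup.closure {Agen2, Tgen2, Ugen2} := by
  have hz : ofAdd z = ofAdd (1 : Zsqrtd (-2)) ^ z.re * ofAdd Zsqrtd.sqrtd ^ z.im := by
    rw [← ofAdd_zsmul, ← ofAdd_zsmul, ← ofAdd_add]
    congr 1
    ext <;> simp
  rw [hz, map_mul, map_zpow, map_zpow]
  exact mul_mem (zpow_mem (Subgroup.subset_closure (.inr (.inl rfl))) _)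
    (zpow_mem (Subgroup.subset_closure (.inr (.inr rfl))) _)

theorem coe_Agen2 : (Agen2 : Matrix (Fin 2) (Fin 2) (Zsqrtd (-2))) = !![0, -1; 1, 0] :=
  rfl

theorem Agen2_mem_closure : Agen2 ∈ Subgroup.closure {Agen2, Tgen2, Ugen2} :=
  Subgroup.subset_closure (.inl rfl)

theorem mem_closure_of_lower_left_eq_zero_s5
    (g : Matrix.SpecialLinearGroup (Fin 2) (Zsqrtd (-2))) (hg : g 1 0 = 0) :
    g ∈ Subgroup.closure {Agen2, Tgen2, Ugen2} := by
  have hdet : g 0 0 * g 1 1 = 1 := by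
    have := g.det_coe
    rwa [Matrix.det_fin_two, hg, mul_zero, sub_zero] at this
  rcases Zsqrtd.eq_one_or_eq_neg_one_of_isUnit (IsUnit.of_mul_eq_one _ hdet) with h | h
  · have h' : g 1 1 = 1 := by simpa [h] using hdet
    convert upperUnipotent_mem_closure (g 0 1)
    refine Matrix.SpecialLinearGroup.ext _ _ fun i j => ?_
    fin_cases i <;> fin_cases j <;> simp [coe_upperUnipotent, h, h', hg]
  · have h' : g 1 1 = -1 := by
      rw [h] at hdet
      linear_combination -hdet
    convert mul_mem (mul_mem Agen2_mem_closure Agen2_mem_closure)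
      (upperUnipotent_mem_closure (-g 0 1))
    refine Matrix.SpecialLinearGroup.ext _ _ fun i j => ?_
    fin_cases i <;> fin_cases j <;>
      simp [coe_upperUnipotent, coe_Agen2, Matrix.mul_apply, Fin.sum_univ_two, h, h', hg]

theorem stmt_5 :
    Subgroup.closure {Agen2, Tgen2, Ugen2} =
      (⊤ : Subgroup (Matrix.SpecialLinearGroup (Fin 2) (Zsqrtd (-2)))) := by
  rw [eq_top_iff]
  rintro g -
  induction hn : (g 1 0).norm.natAbs using Nat.strong_induction_on generalizing g with
  | _ n ih =>
    by_cases hc : g 1 0 = 0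
    · exact mem_closure_of_lower_left_eq_zero_s5 g hc
    obtain ⟨q, hq⟩ := Zsqrtd.exists_norm_sub_mul_lt (g 0 0) hc
    have hmem := mul_mem Agen2_mem_closure (upperUnipotent_mem_closure (-q))
    rw [← Subgroup.mul_mem_cancel_left _ hmem]
    refine ih _ ?_ rfl
    have hentry : (Agen2 * upperUnipotent (ofAdd (-q)) * g) 1 0 = g 0 0 - q * g 1 0 := by
      simp [coe_upperUnipotent, coe_Agen2, Matrix.mul_apply, Fin.sum_univ_two, sub_eq_add_neg]
    rw [hentry, ← hn]
    have := Zsqrtd.norm_nonneg (by norm_num) (g 0 0 - q * g 1 0)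
    lia
end

section
/- Let M = !![α, β; γ, δ] be a 2×2 matrix over ℤ[√-2] with determinant αδ − βγ = 1 and γ ≠ 0, and let θ ∈ ℤ[√-2] satisfy 4·N(θ·γ + δ) ≤ 3·N(γ). Define M' := !![θ·α + β, −α; θ·γ + δ, −γ]. Then ‖M'‖ ≤ ‖M‖. -/
open Matrix

/-- The norm of a `2 × 2` matrix over `ℤ[√-2]`: the maximum of the field norms
of its four entries. -/
def matNorm2 (M : Matrix (Fin 2) (Fin 2) (Zsqrtd (-2))) : ℤ :=
  max (max (Zsqrtd.norm (M 0 0)) (Zsqrtd.norm (M 0 1)))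
      (max (Zsqrtd.norm (M 1 0)) (Zsqrtd.norm (M 1 1)))

/-- If `b * γ = α * ρ - 1` with `N ρ < N γ`, then `N b` is at most `max (N α) (N γ)`. -/
theorem norm_le_max_of_mul_eq_mul_sub_one {α γ ρ b : Zsqrtd (-2)}
    (h : b * γ = α * ρ - 1) (hρ : ρ.norm < γ.norm) : b.norm ≤ max α.norm γ.norm := by
  have hnn (z : Zsqrtd (-2)) : 0 ≤ z.norm := Zsqrtd.norm_nonneg (by norm_num) z
  have hN : b.norm * γ.norm = α.norm * ρ.norm - 2 * (α * ρ).re + 1 := by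
    rw [← Zsqrtd.norm_mul, ← Zsqrtd.norm_mul, h]
    simp only [Zsqrtd.norm_def, Zsqrtd.re_sub, Zsqrtd.im_sub, Zsqrtd.re_one, Zsqrtd.im_one]
    ring
  have hre : (α * ρ).re ^ 2 ≤ α.norm * ρ.norm := by
    rw [← Zsqrtd.norm_mul, Zsqrtd.norm_def]
    nlinarith [sq_nonneg (α * ρ).im]
  by_contra! hb
  set m := max α.norm γ.norm
  have hαm : α.norm ≤ m := le_max_left _ _
  have hγm : γ.norm ≤ m := le_max_right _ _
  have hP : α.norm * ρ.norm ≤ m * (γ.norm - 1) :=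
    mul_le_mul hαm (by lia) (hnn ρ) ((hnn α).trans hαm)
  have hB : (m + 1) * γ.norm ≤ b.norm * γ.norm :=
    mul_le_mul_of_nonneg_right (by lia) (hnn γ)
  have hlt : -(2 * (α * ρ).re) < m + γ.norm - 1 := by
    refine lt_of_pow_lt_pow_left₀ 2 (by linarith [hnn ρ]) ?_
    have hpos : 0 < (m - (γ.norm - 1)) ^ 2 := pow_pos (by linarith) 2
    nlinarith
  linarith

theorem stmt_7 (α β γ δ θ : Zsqrtd (-2))
    (hdet : α * δ - β * γ = 1) (hγ : γ ≠ 0)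
    (hθ : 4 * Zsqrtd.norm (θ * γ + δ) ≤ 3 * Zsqrtd.norm γ) :
    matNorm2 !![θ * α + β, -α; θ * γ + δ, -γ] ≤ matNorm2 !![α, β; γ, δ] := by
  have hγ0 : 0 < γ.norm := by
    refine lt_of_le_of_ne (Zsqrtd.norm_nonneg (by norm_num) γ) fun h => hγ ?_
    exact (Zsqrtd.norm_eq_zero_iff (by norm_num) γ).1 h.symm
  have hρ : (θ * γ + δ).norm < γ.norm := by linarith
  have hb : (θ * α + β).norm ≤ max α.norm γ.norm :=
    norm_le_max_of_mul_eq_mul_sub_one (by linear_combination -hdet) hρ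
  simp only [matNorm2, Matrix.of_apply, Matrix.cons_val', Matrix.cons_val_zero,
    Matrix.cons_val_one, Matrix.cons_val_fin_one, Zsqrtd.norm_neg]
  lia
end

section
/- The group homomorphism φ from the free group on two generators a, b into SL(2, ℤ) determined by φ(a) = !![1, 2; 0, 1] and φ(b) = !![1, 0; 2, 1] is injective. -/
open Matrix

/-- The image of the first generator: `!![1, 2; 0, 1] ∈ SL(2, ℤ)`. -/
def genA : Matrix.SpecialLinearGroup (Fin 2) ℤ :=
  ⟨!![1, 2; 0, 1], by simp [Matrix.det_fin_two_of]⟩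

/-- The image of the second generator: `!![1, 0; 2, 1] ∈ SL(2, ℤ)`. -/
def genB : Matrix.SpecialLinearGroup (Fin 2) ℤ :=
  ⟨!![1, 0; 2, 1], by simp [Matrix.det_fin_two_of]⟩

/-- The elements of `SL(2, ℤ)` whose first column `(x, y)` has slope `x / y ∈ [1, ∞]`
(for index `0`) or `x / y ∈ (0, 1)` (for index `1`): the attracting sets of `genA` and `genB`. -/
def attractingSet : Fin 2 → Set (Matrix.SpecialLinearGroup (Fin 2) ℤ) :=
  ![{g | g 1 0 ^ 2 ≤ g 0 0 * g 1 0}, {g | g 0 0 ^ 2 < g 0 0 * g 1 0}]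

/-- The elements of `SL(2, ℤ)` whose first column `(x, y)` has slope `x / y ∈ (-∞, -1)`
(for index `0`) or `x / y ∈ [-1, 0]` (for index `1`): the attracting sets of `genA⁻¹` and
`genB⁻¹`. -/
def repellingSet : Fin 2 → Set (Matrix.SpecialLinearGroup (Fin 2) ℤ) :=
  ![{g | g 0 0 * g 1 0 < -g 1 0 ^ 2}, {g | g 0 0 * g 1 0 ≤ -g 0 0 ^ 2}]

theorem coe_genA : (genA : Matrix (Fin 2) (Fin 2) ℤ) = !![1, 2; 0, 1] := rfl

theorem coe_genB : (genB : Matrix (Fin 2) (Fin 2) ℤ) = !![1, 0; 2, 1] := rfl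

theorem coe_genA_inv : (↑genA⁻¹ : Matrix (Fin 2) (Fin 2) ℤ) = !![1, -2; 0, 1] := by
  rw [Matrix.SpecialLinearGroup.coe_inv, coe_genA, Matrix.adjugate_fin_two_of, neg_zero]

theorem coe_genB_inv : (↑genB⁻¹ : Matrix (Fin 2) (Fin 2) ℤ) = !![1, 0; -2, 1] := by
  rw [Matrix.SpecialLinearGroup.coe_inv, coe_genB, Matrix.adjugate_fin_two_of, neg_zero]

theorem sq_add_sq_first_column_pos (g : Matrix.SpecialLinearGroup (Fin 2) ℤ) :
    0 < g 0 0 ^ 2 + g 1 0 ^ 2 := by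
  have hdet := g.det_coe
  rw [Matrix.det_fin_two] at hdet
  by_contra! h
  have hx : g 0 0 = 0 := by nlinarith [sq_nonneg (g 0 0), sq_nonneg (g 1 0)]
  have hy : g 1 0 = 0 := by nlinarith [sq_nonneg (g 0 0), sq_nonneg (g 1 0)]
  simp [hx, hy] at hdet

theorem attractingSet_nonempty (i : Fin 2) : (attractingSet i).Nonempty := by
  fin_cases i
  · exact ⟨1, by simp [attractingSet]⟩
  · exact ⟨genB, by simp [attractingSet, coe_genB]⟩

theorem attractingSet_disjoint_repellingSet (i j : Fin 2) :
    Disjoint (attractingSet i) (repellingSet j) := by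
  rw [Set.disjoint_left]
  intro g hg hg'
  have := sq_add_sq_first_column_pos g
  fin_cases i <;> fin_cases j <;> simp [attractingSet, repellingSet] at hg hg' <;>
    nlinarith [sq_nonneg (g 0 0), sq_nonneg (g 1 0)]

open scoped Function in
theorem pairwise_disjoint_attractingSet : Pairwise (Disjoint on attractingSet) := by
  rw [pairwise_disjoint_on]
  intro i j hij
  rw [Set.disjoint_left]
  intro g hg hg'
  fin_cases i <;> fin_cases j <;> simp [attractingSet] at hij hg hg'
  nlinarith [sq_nonneg (g 0 0 - g 1 0)]

open scoped Function in
theorem pairwise_disjoint_repellingSet : Pairwise (Disjoint on repellingSet) := by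
  rw [pairwise_disjoint_on]
  intro i j hij
  rw [Set.disjoint_left]
  intro g hg hg'
  fin_cases i <;> fin_cases j <;> simp [repellingSet] at hij hg hg'
  nlinarith [sq_nonneg (g 0 0 + g 1 0)]

open scoped Pointwise in
theorem smul_compl_repellingSet_subset (i : Fin 2) :
    (![genA, genB] : Fin 2 → Matrix.SpecialLinearGroup (Fin 2) ℤ) i • (repellingSet i)ᶜ ⊆ attractingSet i := by
  rintro _ ⟨g, hg, rfl⟩
  fin_cases i <;>
    simp [attractingSet, repellingSet, smul_eq_mul, coe_genA, coe_genB, Matrix.mul_apply,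
      Fin.sum_univ_two] at hg ⊢ <;>
    nlinarith

open scoped Pointwise in
theorem inv_smul_compl_attractingSet_subset (i : Fin 2) :
    (![genA, genB] : Fin 2 → Matrix.SpecialLinearGroup (Fin 2) ℤ)⁻¹ i • (attractingSet i)ᶜ ⊆ repellingSet i := by
  rintro _ ⟨g, hg, rfl⟩
  fin_cases i <;>
    simp [attractingSet, repellingSet, smul_eq_mul, coe_genA_inv, coe_genB_inv,
      Matrix.mul_apply, Fin.sum_univ_two, -Matrix.SpecialLinearGroup.coe_inv] at hg ⊢ <;>
    nlinarith

theorem stmt_8 :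
    Function.Injective (FreeGroup.lift (![genA, genB] : Fin 2 → _)) := by
  exact FreeGroup.injective_lift_of_ping_pong _ attractingSet repellingSet
    attractingSet_nonempty pairwise_disjoint_attractingSet pairwise_disjoint_repellingSet
    attractingSet_disjoint_repellingSet smul_compl_repellingSet_subset
    inv_smul_compl_attractingSet_subset
end

section
/- The group homomorphism φ from the free group on two generators a, b into the group of invertible 2×2 complex matrices determined by φ(a) = !![3/5 + (4/5)·i, 0; 0, 3/5 − (4/5)·i] and φ(b) = !![3/5, 4/5; −4/5, 3/5] is injective. -/
open Matrix Complex

/-- The image of the first generator: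
`!![3/5 + (4/5)i, 0; 0, 3/5 - (4/5)i] ∈ GL(2, ℂ)`. -/
noncomputable def glA : GL (Fin 2) ℂ :=
  Matrix.GeneralLinearGroup.mkOfDetNeZero
    !![3/5 + (4/5) * Complex.I, 0; 0, 3/5 - (4/5) * Complex.I]
    (by
      simp only [Matrix.det_fin_two_of]
      ring_nf
      simp [Complex.ext_iff]
      norm_num)

/-- The image of the second generator: `!![3/5, 4/5; -4/5, 3/5] ∈ GL(2, ℂ)`. -/
noncomputable def glB : GL (Fin 2) ℂ :=
  Matrix.GeneralLinearGroup.mkOfDetNeZero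
    !![3/5, 4/5; -(4/5), 3/5]
    (by
      simp only [Matrix.det_fin_two_of]
      norm_num)

/-- The letters of the free group on two generators, scaled by `5`, as matrices of Gaussian
integers. -/
def scaledLetter : Fin 2 × Bool → Matrix (Fin 2) (Fin 2) GaussianInt
  | (0, true) => !![⟨3, 4⟩, 0; 0, ⟨3, -4⟩]
  | (0, false) => !![⟨3, -4⟩, 0; 0, ⟨3, 4⟩]
  | (1, true) => !![3, 4; -4, 3]
  | (1, false) => !![3, -4; 4, 3]

/-- The reduction `ℤ[i] → ℤ/5` sending `i` to `3`. -/
def gaussianIntModFive : GaussianInt →+* ZMod 5 :=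
  Zsqrtd.lift ⟨3, by decide⟩

/-- The column factor of the rank-one reduction of `scaledLetter`. -/
def letterCol : Fin 2 × Bool → Fin 2 → ZMod 5
  | (0, true) => ![0, 1]
  | (0, false) => ![1, 0]
  | (1, true) => ![3, 1]
  | (1, false) => ![1, 3]

/-- The row factor of the rank-one reduction of `scaledLetter`. -/
def letterRow : Fin 2 × Bool → Fin 2 → ZMod 5
  | (0, true) => ![0, 1]
  | (0, false) => ![1, 0]
  | (1, true) => ![1, 3]
  | (1, false) => ![3, 1]

theorem map_scaledLetter_modFive (x : Fin 2 × Bool) :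
    gaussianIntModFive.mapMatrix (scaledLetter x) = vecMulVec (letterCol x) (letterRow x) := by
  revert x
  decide

theorem letterRow_ne_zero (x : Fin 2 × Bool) : letterRow x ≠ 0 := by
  revert x
  decide

theorem letterRow_dotProduct_letterCol_ne_zero (x y : Fin 2 × Bool) (h : x.1 = y.1 → x.2 = y.2) :
    letterRow x ⬝ᵥ letterCol y ≠ 0 := by
  revert x y
  decide

theorem letterRow_vecMul_prod_ne_zero (x : Fin 2 × Bool) (L : List (Fin 2 × Bool))
    (h : FreeGroup.IsReduced (x :: L)) :
    letterRow x ᵥ* gaussianIntModFive.mapMatrix (L.map scaledLetter).prod ≠ 0 := by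
  induction L generalizing x with
  | nil => simpa using letterRow_ne_zero x
  | cons y L ih =>
    rw [FreeGroup.IsReduced, List.isChain_cons_cons] at h
    have : Fact (Nat.Prime 5) := ⟨by norm_num⟩
    rw [List.map_cons, List.prod_cons, map_mul, map_scaledLetter_modFive, ← vecMul_vecMul,
      vecMul_vecMulVec, smul_vecMul]
    exact smul_ne_zero (letterRow_dotProduct_letterCol_ne_zero x y h.1) (ih y h.2)

theorem map_prod_scaledLetter_ne_zero (L : List (Fin 2 × Bool)) (h : FreeGroup.IsReduced L) :
    gaussianIntModFive.mapMatrix (L.map scaledLetter).prod ≠ 0 := by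
  cases L with
  | nil => rw [List.map_nil, List.prod_nil, map_one]; decide
  | cons x L =>
    intro h0
    refine letterRow_vecMul_prod_ne_zero x (x :: L) ?_ (by rw [h0, vecMul_zero])
    rw [FreeGroup.IsReduced, List.isChain_cons_cons]
    exact ⟨fun _ => rfl, h⟩

theorem toComplex_scaledLetter (x : Fin 2 × Bool) :
    GaussianInt.toComplex.mapMatrix (scaledLetter x) =
      (5 : ℂ) • ((cond x.2 ((![glA, glB] : Fin 2 → GL (Fin 2) ℂ) x.1)
        ((![glA, glB] : Fin 2 → GL (Fin 2) ℂ) x.1)⁻¹ : GL (Fin 2) ℂ) :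
          Matrix (Fin 2) (Fin 2) ℂ) := by
  have hA : (3 / 5 + 4 / 5 * Complex.I) * (3 / 5 - 4 / 5 * Complex.I) = 1 := by
    linear_combination (-16 / 25) * Complex.I_sq
  have hB : (3 / 5 * (3 / 5) + 4 / 5 * (4 / 5) : ℂ) = 1 := by norm_num
  obtain ⟨i, b⟩ := x
  fin_cases i <;> cases b <;> ext i j <;> fin_cases i <;> fin_cases j <;>
    simp [scaledLetter, glA, glB, GaussianInt.toComplex_def, Matrix.inv_def, adjugate_fin_two,
      det_fin_two, hA, hB, GeneralLinearGroup.mkOfDetNeZero] <;> ring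

theorem toComplex_prod_scaledLetter (L : List (Fin 2 × Bool)) :
    GaussianInt.toComplex.mapMatrix (L.map scaledLetter).prod =
      (5 : ℂ) ^ L.length •
        ((FreeGroup.lift (![glA, glB] : Fin 2 → GL (Fin 2) ℂ) (FreeGroup.mk L) : GL (Fin 2) ℂ) :
          Matrix (Fin 2) (Fin 2) ℂ) := by
  induction L with
  | nil => simp
  | cons x L ih =>
    rw [FreeGroup.lift_mk] at ih ⊢
    rw [List.map_cons, List.prod_cons, map_mul, ih, toComplex_scaledLetter, List.map_cons,
      List.prod_cons, Units.val_mul, smul_mul_smul_comm, List.length_cons, pow_succ']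

theorem stmt_9 :
    Function.Injective (FreeGroup.lift (![glA, glB] : Fin 2 → GL (Fin 2) ℂ)) := by
  rw [injective_iff_map_eq_one]
  intro g hg
  have hprod := toComplex_prod_scaledLetter g.toWord
  rw [FreeGroup.mk_toWord, hg, Units.val_one] at hprod
  have hint : (g.toWord.map scaledLetter).prod = (5 : GaussianInt) ^ g.toWord.length • 1 := by
    refine Matrix.map_injective (f := GaussianInt.toComplex) GaussianInt.toComplex_injective ?_
    refine hprod.trans ?_
    ext i j
    by_cases hij : i = j <;> simp [hij, map_ofNat GaussianInt.toComplex 5]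
  by_contra hne
  have hlen : g.toWord.length ≠ 0 := by simpa using hne
  refine map_prod_scaledLetter_ne_zero g.toWord FreeGroup.isReduced_toWord ?_
  have h5 : gaussianIntModFive 5 = 0 := by decide
  rw [hint]
  ext i j
  simp [h5, hlen]
end

section
/- For every nilpotent group G there is no injective monoid homomorphism from the free monoid on two generators into G. -/
/-- The pairs of Malcev words in `a` and `b`: starting from `(a, b)`, each step
replaces `(x, y)` by `(x * y, y * x)`. -/
def malcevPair {M : Type*} [Mul M] (a b : M) : ℕ → M × M
  | 0 => (a, b)
  | n + 1 => ((malcevPair a b n).1 * (malcevPair a b n).2,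
      (malcevPair a b n).2 * (malcevPair a b n).1)

theorem map_malcevPair {M N : Type*} [Monoid M] [Monoid N] (φ : M →* N) (a b : M) (n : ℕ) :
    malcevPair (φ a) (φ b) n = (φ (malcevPair a b n).1, φ (malcevPair a b n).2) := by
  induction n with
  | zero => rfl
  | succ n ih => simp [malcevPair, ih]

theorem malcevPair_div_mem_lowerCentralSeries {G : Type*} [Group G] (a b : G) (n : ℕ) :
    (malcevPair a b n).1 * (malcevPair a b n).2⁻¹ ∈
      (⊤ : Subgroup G).lowerCentralSeries n := by
  induction n with
  | zero => simp
  | succ n ih =>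
    have h := Subgroup.commutator_mem_commutator ih
      (Subgroup.mem_top (malcevPair a b n).2)
    rw [Subgroup.lowerCentralSeries_succ]
    convert h using 1
    simp only [malcevPair, commutatorElement_def]
    group

theorem exists_malcevPair_eq (G : Type*) [Group G] [Group.IsNilpotent G] :
    ∃ n, ∀ a b : G, (malcevPair a b n).1 = (malcevPair a b n).2 := by
  obtain ⟨n, hn⟩ := Subgroup.nilpotent_iff_lowerCentralSeries.mp ‹Group.IsNilpotent G›
  refine ⟨n, fun a b => mul_inv_eq_one.mp ?_⟩
  simpa [hn] using malcevPair_div_mem_lowerCentralSeries a b n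

theorem FreeMonoid.length_malcevPair {α : Type*} {a b : FreeMonoid α}
    (h : a.length = b.length) (n : ℕ) :
    (malcevPair a b n).1.length = (malcevPair a b n).2.length := by
  induction n with
  | zero => exact h
  | succ n ih => simp [malcevPair, FreeMonoid.length_mul, ih]

theorem FreeMonoid.malcevPair_ne {α : Type*} {a b : FreeMonoid α}
    (h : a.length = b.length) (hab : a ≠ b) (n : ℕ) :
    (malcevPair a b n).1 ≠ (malcevPair a b n).2 := by
  induction n with
  | zero => exact hab
  | succ n ih =>
    exact fun heq => ih (List.append_inj heq (length_malcevPair h n)).1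

theorem stmt_12 (G : Type*) [Group G] [Group.IsNilpotent G] :
    ¬ ∃ φ : FreeMonoid (Fin 2) →* G, Function.Injective φ := by
  rintro ⟨φ, hφ⟩
  obtain ⟨n, hn⟩ := exists_malcevPair_eq G
  have hne : FreeMonoid.of (0 : Fin 2) ≠ FreeMonoid.of 1 :=
    FreeMonoid.of_injective.ne zero_ne_one
  refine FreeMonoid.malcevPair_ne (by simp) hne n (hφ ?_)
  simpa [map_malcevPair] using hn (φ (FreeMonoid.of 0)) (φ (FreeMonoid.of 1))
end

section
/- The monoid homomorphism φ from (free group on two generators a, b) × (infinite cyclic group generated by c) into the multiplicative monoid of 2×2 rational matrices determined by φ(a, 0) = !![1, 2; 0, 1], φ(b, 0) = !![1, 0; 2, 1], and φ(1, c) = !![2, 0; 0, 2] is injective. In other words, there is an injective monoid homomorphism from FreeGroup (Fin 2) × Multiplicative ℤ into Matrix (Fin 2) (Fin 2) ℚ with these images of the generators. -/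
open Matrix

namespace Sanov

open scoped MatrixGroups Pointwise

/-- The action of `SL(2, ℚ)` on the nonzero vectors of `ℚ²`. -/
instance nonzeroVectorAction : MulAction SL(2, ℚ) {v : Fin 2 → ℚ // v ≠ 0} where
  smul g v := ⟨g • v.1, (smul_ne_zero_iff_ne g).mpr v.2⟩
  one_smul v := Subtype.ext (one_smul _ v.1)
  mul_smul g h v := Subtype.ext (mul_smul g h v.1)

theorem coe_smul (g : SL(2, ℚ)) (v : {v : Fin 2 → ℚ // v ≠ 0}) :
    (g • v).1 = (g : Matrix (Fin 2) (Fin 2) ℚ) *ᵥ v.1 := rfl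

theorem coe_inv_smul (g : SL(2, ℚ)) (v : {v : Fin 2 → ℚ // v ≠ 0}) :
    (g⁻¹ • v).1 = adjugate (g : Matrix (Fin 2) (Fin 2) ℚ) *ᵥ v.1 := rfl

/-- The two unipotent generators of the Sanov subgroup. -/
def generator : Fin 2 → SL(2, ℚ) :=
  ![⟨!![1, 2; 0, 1], by simp [det_fin_two]⟩, ⟨!![1, 0; 2, 1], by simp [det_fin_two]⟩]

/-- The sets into which the generators attract. -/
def attracting : Fin 2 → Set {v : Fin 2 → ℚ // v ≠ 0} :=
  ![{v | v.1 1 ^ 2 ≤ v.1 0 * v.1 1}, {v | v.1 0 = 0 ∨ v.1 0 ^ 2 < v.1 0 * v.1 1}]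

/-- The sets into which the inverses of the generators attract. -/
def repelling : Fin 2 → Set {v : Fin 2 → ℚ // v ≠ 0} :=
  ![{v | v.1 0 * v.1 1 < -v.1 1 ^ 2}, {v | v.1 0 ≠ 0 ∧ v.1 0 * v.1 1 ≤ -v.1 0 ^ 2}]

theorem coord_ne_zero (v : {v : Fin 2 → ℚ // v ≠ 0}) (h : v.1 0 = 0) : v.1 1 ≠ 0 :=
  fun h' => v.2 (by ext i; fin_cases i <;> assumption)

theorem disjoint_attracting_zero_one : Disjoint (attracting 0) (attracting 1) := by
  refine Set.disjoint_left.mpr fun v hv hw => ?_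
  change v.1 1 ^ 2 ≤ v.1 0 * v.1 1 at hv
  change v.1 0 = 0 ∨ v.1 0 ^ 2 < v.1 0 * v.1 1 at hw
  rcases hw with h | h
  · have := coord_ne_zero v h
    rw [h, zero_mul] at hv
    have : 0 < v.1 1 ^ 2 := by positivity
    linarith
  · nlinarith [sq_nonneg (v.1 0 - v.1 1)]

theorem disjoint_repelling_zero_one : Disjoint (repelling 0) (repelling 1) := by
  refine Set.disjoint_left.mpr fun v hv hw => ?_
  change v.1 0 * v.1 1 < -v.1 1 ^ 2 at hv
  obtain ⟨-, hw⟩ : v.1 0 ≠ 0 ∧ v.1 0 * v.1 1 ≤ -v.1 0 ^ 2 := hw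
  nlinarith [sq_nonneg (v.1 0 + v.1 1)]

theorem disjoint_attracting_repelling (i j : Fin 2) :
    Disjoint (attracting i) (repelling j) := by
  refine Set.disjoint_left.mpr fun v hv hw => ?_
  have h0 := sq_nonneg (v.1 0)
  have h1 := sq_nonneg (v.1 1)
  fin_cases i <;> fin_cases j <;> simp [attracting, repelling] at hv hw
  · linarith
  · have : 0 < v.1 0 ^ 2 := by have := hw.1; positivity
    linarith
  · rcases hv with h | h
    · rw [h, zero_mul] at hw
      linarith
    · linarith
  · rcases hv with h | h
    · exact hw.1 h
    · linarith

theorem generator_zero_smul (v : {v : Fin 2 → ℚ // v ≠ 0}) :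
    (generator 0 • v).1 = ![v.1 0 + 2 * v.1 1, v.1 1] := by
  rw [coe_smul]
  ext i
  fin_cases i <;> simp [generator, mulVec, dotProduct, Fin.sum_univ_two]

theorem generator_one_smul (v : {v : Fin 2 → ℚ // v ≠ 0}) :
    (generator 1 • v).1 = ![v.1 0, 2 * v.1 0 + v.1 1] := by
  rw [coe_smul]
  ext i
  fin_cases i <;> simp [generator, mulVec, dotProduct, Fin.sum_univ_two]

theorem generator_zero_inv_smul (v : {v : Fin 2 → ℚ // v ≠ 0}) :
    (generator⁻¹ 0 • v).1 = ![v.1 0 - 2 * v.1 1, v.1 1] := by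
  rw [Pi.inv_apply, coe_inv_smul, adjugate_fin_two]
  ext i
  fin_cases i <;> simp [generator, mulVec, dotProduct, Fin.sum_univ_two] <;> ring

theorem generator_one_inv_smul (v : {v : Fin 2 → ℚ // v ≠ 0}) :
    (generator⁻¹ 1 • v).1 = ![v.1 0, v.1 1 - 2 * v.1 0] := by
  rw [Pi.inv_apply, coe_inv_smul, adjugate_fin_two]
  ext i
  fin_cases i <;> simp [generator, mulVec, dotProduct, Fin.sum_univ_two] <;> ring

theorem generator_smul_subset (i : Fin 2) : generator i • (repelling i)ᶜ ⊆ attracting i := by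
  rintro _ ⟨v, hv, rfl⟩
  fin_cases i
  · change ¬ v.1 0 * v.1 1 < -v.1 1 ^ 2 at hv
    change (generator 0 • v).1 1 ^ 2 ≤ (generator 0 • v).1 0 * (generator 0 • v).1 1
    simp only [generator_zero_smul, cons_val_zero, cons_val_one]
    linarith
  · change ¬ (v.1 0 ≠ 0 ∧ v.1 0 * v.1 1 ≤ -v.1 0 ^ 2) at hv
    change (generator 1 • v).1 0 = 0 ∨
      (generator 1 • v).1 0 ^ 2 < (generator 1 • v).1 0 * (generator 1 • v).1 1
    simp only [generator_one_smul, cons_val_zero, cons_val_one]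
    by_cases h : v.1 0 = 0
    · exact Or.inl h
    · right
      by_contra h'
      exact hv ⟨h, by linarith⟩

theorem generator_inv_smul_subset (i : Fin 2) :
    generator⁻¹ i • (attracting i)ᶜ ⊆ repelling i := by
  rintro _ ⟨v, hv, rfl⟩
  fin_cases i
  · change ¬ v.1 1 ^ 2 ≤ v.1 0 * v.1 1 at hv
    change (generator⁻¹ 0 • v).1 0 * (generator⁻¹ 0 • v).1 1 < -(generator⁻¹ 0 • v).1 1 ^ 2
    simp only [generator_zero_inv_smul, cons_val_zero, cons_val_one]
    linarith
  · change ¬ (v.1 0 = 0 ∨ v.1 0 ^ 2 < v.1 0 * v.1 1) at hv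
    change (generator⁻¹ 1 • v).1 0 ≠ 0 ∧
      (generator⁻¹ 1 • v).1 0 * (generator⁻¹ 1 • v).1 1 ≤ -(generator⁻¹ 1 • v).1 0 ^ 2
    simp only [generator_one_inv_smul, cons_val_zero, cons_val_one]
    push Not at hv
    exact ⟨hv.1, by linarith [hv.2]⟩

theorem lift_generator_injective : Function.Injective (FreeGroup.lift generator) := by
  refine FreeGroup.injective_lift_of_ping_pong generator attracting repelling ?_ ?_ ?_
    disjoint_attracting_repelling generator_smul_subset generator_inv_smul_subset
  · intro i
    fin_cases i
    · exact ⟨⟨![1, 0], by simp⟩, by simp [attracting]⟩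
    · exact ⟨⟨![0, 1], by simp⟩, by simp [attracting]⟩
  · intro i j hij
    fin_cases i <;> fin_cases j <;> first | exact absurd rfl hij | skip
    · exact disjoint_attracting_zero_one
    · exact disjoint_attracting_zero_one.symm
  · intro i j hij
    fin_cases i <;> fin_cases j <;> first | exact absurd rfl hij | skip
    · exact disjoint_repelling_zero_one
    · exact disjoint_repelling_zero_one.symm

/-- The representation of `F₂ × ℤ` through the Sanov subgroup and the powers of the scalar `2`. -/
def representation : FreeGroup (Fin 2) × Multiplicative ℤ →* Matrix (Fin 2) (Fin 2) ℚ where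
  toFun p := (2 : ℚ) ^ p.2.toAdd • (FreeGroup.lift generator p.1 : Matrix (Fin 2) (Fin 2) ℚ)
  map_one' := by simp
  map_mul' p q := by simp [zpow_add₀, smul_smul, mul_comm]

theorem representation_apply (p : FreeGroup (Fin 2) × Multiplicative ℤ) :
    representation p =
      (2 : ℚ) ^ p.2.toAdd • (FreeGroup.lift generator p.1 : Matrix (Fin 2) (Fin 2) ℚ) := rfl

theorem representation_injective : Function.Injective representation := by
  rintro ⟨w, m⟩ ⟨w', n⟩ h
  simp only [representation_apply] at h
  have hdet := congrArg det h
  simp only [det_smul, (FreeGroup.lift generator _).2, Fintype.card_fin, mul_one] at hdet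
  have hpow : (2 : ℚ) ^ m.toAdd = 2 ^ n.toAdd :=
    (pow_left_inj₀ (by positivity) (by positivity) two_ne_zero).mp hdet
  have hmn : m = n := Multiplicative.toAdd.injective
    (zpow_right_injective₀ (by norm_num) (by norm_num) hpow)
  rw [hpow] at h
  have hw := lift_generator_injective
    (Subtype.ext (smul_right_injective _ (zpow_ne_zero _ (two_ne_zero (α := ℚ))) h))
  rw [hmn, hw]

end Sanov

theorem stmt_13 :
    ∃ φ : FreeGroup (Fin 2) × Multiplicative ℤ →* Matrix (Fin 2) (Fin 2) ℚ,
      φ (FreeGroup.of 0, 1) = !![1, 2; 0, 1] ∧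
      φ (FreeGroup.of 1, 1) = !![1, 0; 2, 1] ∧
      φ (1, Multiplicative.ofAdd 1) = !![2, 0; 0, 2] ∧
      Function.Injective φ := by
  refine ⟨Sanov.representation, ?_, ?_, ?_, Sanov.representation_injective⟩
  · simp [Sanov.representation_apply, Sanov.generator]
  · simp [Sanov.representation_apply, Sanov.generator]
  · ext i j
    fin_cases i <;> fin_cases j <;> simp [Sanov.representation_apply]
end

section
/- The map φ from (free group on two generators a, b) × (free monoid on one generator c) into the multiplicative monoid of 2×2 integer matrices sending (w, cⁿ) to σ(w)·(2ⁿ·Id), where σ is the group homomorphism into SL(2, ℤ) determined by σ(a) = !![1, 2; 0, 1] and σ(b) = !![1, 0; 2, 1], is an injective monoid homomorphism. -/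
open Matrix

open scoped MatrixGroups Pointwise

/-- The generators `!![1, 2; 0, 1]` and `!![1, 0; 2, 1]` of the Sanov subgroup of `SL(2, ℤ)`. -/
def sanovGen : Fin 2 → SL(2, ℤ) :=
  ![⟨!![1, 2; 0, 1], by simp⟩, ⟨!![1, 0; 2, 1], by simp⟩]

/-- The matrices whose first column `(x, y)` satisfies `1 ≤ x / y ≤ ∞` (index `0`),
respectively `0 ≤ x / y < 1` (index `1`). -/
def sanovAttracting : Fin 2 → Set SL(2, ℤ) :=
  ![{g | g 1 0 ^ 2 ≤ g 0 0 * g 1 0}, {g | 0 ≤ g 0 0 * g 1 0 ∧ g 0 0 * g 1 0 < g 1 0 ^ 2}]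

/-- The matrices whose first column `(x, y)` satisfies `x / y < -1` (index `0`),
respectively `-1 ≤ x / y < 0` (index `1`). -/
def sanovRepelling : Fin 2 → Set SL(2, ℤ) :=
  ![{g | g 0 0 * g 1 0 < -g 1 0 ^ 2}, {g | -g 1 0 ^ 2 ≤ g 0 0 * g 1 0 ∧ g 0 0 * g 1 0 < 0}]

lemma sq_add_sq_pos_of_first_column (g : SL(2, ℤ)) : 0 < g 0 0 ^ 2 + g 1 0 ^ 2 := by
  have hdet := g.det_coe
  rw [det_fin_two] at hdet
  by_contra! h
  have hx : g 0 0 = 0 := by nlinarith [sq_nonneg (g 0 0), sq_nonneg (g 1 0)]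
  have hy : g 1 0 = 0 := by nlinarith [sq_nonneg (g 0 0), sq_nonneg (g 1 0)]
  simp [hx, hy] at hdet

lemma sanovGen_smul_subset (i : Fin 2) :
    sanovGen i • (sanovRepelling i)ᶜ ⊆ sanovAttracting i := by
  rintro _ ⟨g, hg, rfl⟩
  have hpos := sq_add_sq_pos_of_first_column g
  have happ (k : Fin 2) : (sanovGen i • g) k 0 =
      (sanovGen i) k 0 * g 0 0 + (sanovGen i) k 1 * g 1 0 := by
    exact (mul_apply ..).trans (Fin.sum_univ_two _)
  have h0 := happ 0
  have h1 := happ 1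
  fin_cases i
  · simp [sanovGen] at h0 h1
    simp [sanovAttracting, sanovRepelling, sanovGen, h0, h1] at hg ⊢
    nlinarith
  · simp [sanovGen] at h0 h1
    simp [sanovAttracting, sanovRepelling, sanovGen, h0, h1] at hg ⊢
    generalize g 0 0 = x at *
    generalize g 1 0 = y at *
    by_cases h : -y ^ 2 ≤ x * y
    · have := hg h
      constructor <;> nlinarith
    · constructor <;> nlinarith [sq_nonneg (x + y), sq_nonneg x]

lemma sanovGen_inv_smul_subset (i : Fin 2) :
    sanovGen⁻¹ i • (sanovAttracting i)ᶜ ⊆ sanovRepelling i := by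
  rintro _ ⟨g, hg, rfl⟩
  have hpos := sq_add_sq_pos_of_first_column g
  have happ (k : Fin 2) : (sanovGen⁻¹ i • g) k 0 =
      (sanovGen i).1.adjugate k 0 * g 0 0 + (sanovGen i).1.adjugate k 1 * g 1 0 := by
    exact (mul_apply ..).trans (Fin.sum_univ_two _)
  have h0 := happ 0
  have h1 := happ 1
  fin_cases i
  · simp [sanovGen, adjugate_fin_two] at h0 h1
    simp [sanovAttracting, sanovRepelling, sanovGen, h0, h1] at hg ⊢
    nlinarith
  · simp [sanovGen, adjugate_fin_two] at h0 h1
    simp [sanovAttracting, sanovRepelling, sanovGen, h0, h1] at hg ⊢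
    generalize g 0 0 = x at *
    generalize g 1 0 = y at *
    by_cases h : 0 ≤ x * y
    · have := hg h
      constructor <;> nlinarith [sq_nonneg (x - y), sq_nonneg x]
    · constructor <;> nlinarith [sq_nonneg (x - y), sq_nonneg x]

theorem injective_lift_sanovGen : Function.Injective (FreeGroup.lift sanovGen) := by
  refine FreeGroup.injective_lift_of_ping_pong sanovGen sanovAttracting sanovRepelling
    ?_ ?_ ?_ ?_ sanovGen_smul_subset sanovGen_inv_smul_subset
  · intro i
    fin_cases i
    · exact ⟨1, by simp [sanovAttracting]⟩
    · refine ⟨⟨!![0, -1; 1, 0], by simp⟩, ?_⟩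
      change (0 : ℤ) ≤ 0 * 1 ∧ (0 : ℤ) * 1 < 1 ^ 2
      norm_num
  · intro i j hij
    rw [Function.onFun, Set.disjoint_left]
    intro g
    fin_cases i <;> fin_cases j <;> simp [sanovAttracting] at hij ⊢ <;> grind
  · intro i j hij
    rw [Function.onFun, Set.disjoint_left]
    intro g
    fin_cases i <;> fin_cases j <;> simp [sanovRepelling] at hij ⊢ <;> grind
  · intro i j
    rw [Set.disjoint_left]
    intro g
    have := sq_nonneg (g 1 0)
    fin_cases i <;> fin_cases j <;> (simp [sanovAttracting, sanovRepelling]; grind)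

/-- The homomorphism sending `(w, cⁿ)` to `2 ^ n` times the matrix of `w` in the Sanov group. -/
def scaledSanovHom : FreeGroup (Fin 2) × Multiplicative ℕ →* Matrix (Fin 2) (Fin 2) ℤ where
  toFun p := (2 : ℤ) ^ p.2.toAdd • SpecialLinearGroup.coeMonoidHom (FreeGroup.lift sanovGen p.1)
  map_one' := by simp only [Prod.fst_one, Prod.snd_one, toAdd_one, pow_zero, map_one, one_smul]
  map_mul' p q := by
    simp only [Prod.fst_mul, Prod.snd_mul, map_mul, toAdd_mul, pow_add, smul_mul_smul_comm]

lemma scaledSanovHom_apply (w : FreeGroup (Fin 2)) (n : Multiplicative ℕ) :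
    scaledSanovHom (w, n) =
      (2 : ℤ) ^ n.toAdd • SpecialLinearGroup.coeMonoidHom (FreeGroup.lift sanovGen w) :=
  rfl

theorem injective_scaledSanovHom : Function.Injective scaledSanovHom := by
  rintro ⟨w, n⟩ ⟨v, m⟩ h
  rw [scaledSanovHom_apply, scaledSanovHom_apply] at h
  have hdet_one (g : SL(2, ℤ)) : det (SpecialLinearGroup.coeMonoidHom g) = 1 := g.2
  have hnm : n = m := by
    have hdet := congrArg det h
    simp only [det_smul, hdet_one, Fintype.card_fin, mul_one] at hdet
    have hpow : (2 : ℤ) ^ n.toAdd = 2 ^ m.toAdd :=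
      (pow_left_inj₀ (by positivity) (by positivity) two_ne_zero).mp hdet
    exact Multiplicative.toAdd.injective (Int.pow_right_injective (by decide) hpow)
  subst hnm
  have hw := smul_right_injective _ (pow_ne_zero n.toAdd (two_ne_zero (α := ℤ))) h
  rw [injective_lift_sanovGen (SpecialLinearGroup.coeMonoidHom_injective hw)]

theorem stmt_15 :
    ∃ φ : FreeGroup (Fin 2) × Multiplicative ℕ →* Matrix (Fin 2) (Fin 2) ℤ,
      φ (FreeGroup.of 0, 1) = !![1, 2; 0, 1] ∧
      φ (FreeGroup.of 1, 1) = !![1, 0; 2, 1] ∧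
      (∀ n : ℕ, φ (1, Multiplicative.ofAdd n) =
        ((2 : ℤ) ^ n) • (1 : Matrix (Fin 2) (Fin 2) ℤ)) ∧
      Function.Injective φ := by
  refine ⟨scaledSanovHom, ?_, ?_, fun n => ?_, injective_scaledSanovHom⟩
  · simp [scaledSanovHom_apply, sanovGen]
    rfl
  · simp [scaledSanovHom_apply, sanovGen]
    rfl
  · simp [scaledSanovHom_apply]
end

section
/- Let R be a commutative integral domain whose group of units is a torsion group (every unit of R has finite multiplicative order). Then there is no injective monoid homomorphism from (free monoid on two generators) × (free group on one generator) into the multiplicative monoid of 2×2 matrices over R. In particular, this holds when R is the ring of integers 𝒪_d of an imaginary quadratic field ℚ(√−d) for square-free d ≥ 1, and when R = ℤ. -/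
/-- Over a domain, a `2 × 2` matrix commuting with two noncommuting matrices is scalar. -/
theorem Matrix.eq_scalar_of_commute_of_not_commute {R : Type*} [CommRing R] [IsDomain R]
    {A B C : Matrix (Fin 2) (Fin 2) R} (hA : Commute A C) (hB : Commute B C)
    (hAB : ¬ Commute A B) : C = Matrix.scalar (Fin 2) (C 0 0) := by
  have key : ∀ x : R, x • (A * B) = x • (B * A) → x = 0 := fun x hx ↦
    (smul_eq_zero.1 (by rw [smul_sub, hx, sub_self] : x • (A * B - B * A) = 0)).resolve_right
      fun h ↦ hAB (sub_eq_zero.1 h)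
  have hA' := fun i j ↦ congrFun (congrFun hA.eq i) j
  have hB' := fun i j ↦ congrFun (congrFun hB.eq i) j
  simp only [Matrix.mul_apply, Fin.sum_univ_two, Fin.forall_fin_two] at hA' hB'
  obtain ⟨⟨hA₁, hA₂⟩, hA₃, hA₄⟩ := hA'
  obtain ⟨⟨hB₁, hB₂⟩, hB₃, hB₄⟩ := hB'
  have h : C 0 1 = 0 ∧ C 1 0 = 0 ∧ C 1 1 - C 0 0 = 0 := by
    refine ⟨key _ ?_, key _ ?_, key _ ?_⟩ <;> rw [← Matrix.ext_iff] <;>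
      simp only [Matrix.smul_apply, smul_eq_mul, Matrix.mul_apply, Fin.sum_univ_two,
        Fin.forall_fin_two] <;> refine ⟨⟨?_, ?_⟩, ?_, ?_⟩ <;> clear key <;> grind
  obtain ⟨h₁, h₂, h₃⟩ := h
  ext i j
  fin_cases i <;> fin_cases j <;> simp [h₁, h₂, sub_eq_zero.1 h₃]

/-- If all units of `R` have finite order, then so does every invertible scalar matrix. -/
theorem Matrix.isOfFinOrder_scalar {R n : Type*} [CommRing R] [Fintype n] [DecidableEq n]
    [Nonempty n] (hunits : ∀ u : Rˣ, IsOfFinOrder u) {c : R}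
    (hc : IsUnit (Matrix.scalar n c)) : IsOfFinOrder (Matrix.scalar n c) := by
  have hdet := (Matrix.isUnit_iff_isUnit_det _).1 hc
  rw [Matrix.scalar_apply, Matrix.det_diagonal, Finset.prod_const,
    isUnit_pow_iff Finset.univ_nonempty.card_ne_zero] at hdet
  obtain ⟨u, rfl⟩ := hdet
  exact (Matrix.scalar n).toMonoidHom.isOfFinOrder ((Units.coeHom R).isOfFinOrder (hunits u))

theorem stmt_16 (R : Type*) [CommRing R] [IsDomain R]
    (hunits : ∀ u : Rˣ, IsOfFinOrder u) :
    ¬ ∃ φ : FreeMonoid (Fin 2) × Multiplicative ℤ →* Matrix (Fin 2) (Fin 2) R,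
      Function.Injective φ := by
  rintro ⟨φ, hφ⟩
  let t : FreeMonoid (Fin 2) × Multiplicative ℤ := (1, Multiplicative.ofAdd 1)
  have hcomm : ∀ w : FreeMonoid (Fin 2), Commute (φ (w, 1)) (φ t) := fun w ↦
    Commute.map (Prod.ext (by simp [t]) (by simp [t])) φ
  have hne : ¬ Commute (φ (FreeMonoid.of 0, 1)) (φ (FreeMonoid.of 1, 1)) := fun h ↦ by
    have h' := congrArg (fun x ↦ FreeMonoid.toList x.1)
      (hφ (by simpa only [map_mul] using h.eq) :
        ((FreeMonoid.of 0, 1) * (FreeMonoid.of 1, 1) : FreeMonoid (Fin 2) × Multiplicative ℤ) =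
          (FreeMonoid.of 1, 1) * (FreeMonoid.of 0, 1))
    simp at h'
  have hscalar := Matrix.eq_scalar_of_commute_of_not_commute (hcomm _) (hcomm _) hne
  have hunit : IsUnit (φ t) :=
    (Prod.isUnit_iff.2 ⟨isUnit_one, Group.isUnit _⟩ : IsUnit t).map φ
  have hfin : IsOfFinOrder (φ t) := by
    rw [hscalar] at hunit ⊢
    exact Matrix.isOfFinOrder_scalar hunits hunit
  obtain ⟨n, hn, h⟩ := isOfFinOrder_iff_pow_eq_one.1 (hφ.isOfFinOrder_iff.1 hfin)
  have hsnd := congrArg (fun x ↦ Multiplicative.toAdd x.2) h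
  simp [t, hn.ne'] at hsnd
end

section
/- Let d ∈ {1, 2, 3, 7, 11} and let 𝒪_d be the ring of integers of the imaginary quadratic field ℚ(√−d), realized as a subfield of ℂ. Then there is no injective monoid homomorphism from (free group on two generators) × (free monoid on one generator) into the special linear group SL(2, 𝒪_d). -/
open Matrix

/-- The imaginary quadratic field `ℚ(√-d)`, realized as the subfield of `ℂ`
generated over `ℚ` by `√d · i`. -/
noncomputable def QuadField (d : ℕ) : IntermediateField ℚ ℂ :=
  IntermediateField.adjoin ℚ {(Real.sqrt d : ℂ) * Complex.I}

/-- The ring of integers `𝒪_d` of the imaginary quadratic field `ℚ(√-d)`. -/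
noncomputable def Od (d : ℕ) : Type :=
  NumberField.RingOfIntegers (QuadField d)

noncomputable instance (d : ℕ) : CommRing (Od d) :=
  inferInstanceAs (CommRing (NumberField.RingOfIntegers (QuadField d)))

/-- In a domain, two vectors of length three parallel to a common nonzero vector are parallel:
the equality of one pair of mixed products, given that some coordinate `m` is nonzero. -/
theorem mul_comm_of_parallel {R : Type*} [CommRing R] [IsDomain R] {m x y u₁ u₂ u v₁ v₂ v : R}
    (hm : m ≠ 0) (h₁ : u₁ * m = u * x) (h₂ : u₂ * m = u * y)
    (k₁ : v₁ * m = v * x) (k₂ : v₂ * m = v * y) : u₁ * v₂ = u₂ * v₁ := by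
  apply mul_right_cancel₀ (mul_ne_zero hm hm)
  linear_combination v₂ * m * h₁ - v₁ * m * h₂ + u * x * k₂ - u * y * k₁

/-- Over a domain, two `2 × 2` matrices commuting with a non-scalar matrix commute. -/
theorem Matrix.commute_of_commute_nonscalar {R : Type*} [CommRing R] [IsDomain R]
    {M A B : Matrix (Fin 2) (Fin 2) R}
    (hM : ¬ (M 0 0 = M 1 1 ∧ M 0 1 = 0 ∧ M 1 0 = 0))
    (hA : A * M = M * A) (hB : B * M = M * B) : A * B = B * A := by
  have entries (X Y : Matrix (Fin 2) (Fin 2) R) : X * Y = Y * X ↔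
      X 0 1 * Y 1 0 = X 1 0 * Y 0 1 ∧
      (X 0 0 - X 1 1) * Y 0 1 = X 0 1 * (Y 0 0 - Y 1 1) ∧
      (X 0 0 - X 1 1) * Y 1 0 = X 1 0 * (Y 0 0 - Y 1 1) := by
    simp only [← Matrix.ext_iff, Fin.forall_fin_two, Matrix.mul_apply, Fin.sum_univ_two]
    grind
  rw [entries] at hA hB ⊢
  obtain ⟨a₁, a₂, a₃⟩ := hA
  obtain ⟨b₁, b₂, b₃⟩ := hB
  rw [← sub_eq_zero] at hM
  generalize A 0 0 - A 1 1 = a at *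
  generalize B 0 0 - B 1 1 = b at *
  generalize M 0 0 - M 1 1 = m at *
  by_cases hm : m = 0
  · by_cases hq : M 0 1 = 0
    · have hr : M 1 0 ≠ 0 := fun h => hM ⟨hm, hq, h⟩
      exact ⟨mul_comm_of_parallel hr a₁ rfl b₁ rfl, mul_comm_of_parallel hr a₃ a₁ b₃ b₁,
        mul_comm_of_parallel hr a₃ rfl b₃ rfl⟩
    · exact ⟨mul_comm_of_parallel hq rfl a₁.symm rfl b₁.symm,
        mul_comm_of_parallel hq a₂ rfl b₂ rfl,
        mul_comm_of_parallel hq a₂ a₁.symm b₂ b₁.symm⟩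
  · exact ⟨mul_comm_of_parallel hm a₂.symm a₃.symm b₂.symm b₃.symm,
      mul_comm_of_parallel hm rfl a₂.symm rfl b₂.symm,
      mul_comm_of_parallel hm rfl a₃.symm rfl b₃.symm⟩

/-- A scalar `2 × 2` matrix of determinant one squares to one. -/
theorem Matrix.SpecialLinearGroup.sq_eq_one_of_scalar {R : Type*} [CommRing R]
    {M : SpecialLinearGroup (Fin 2) R}
    (hM : M 0 0 = M 1 1 ∧ M 0 1 = 0 ∧ M 1 0 = 0) : M ^ 2 = 1 := by
  obtain ⟨h, h₁, h₂⟩ := hM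
  have hdet := M.det_coe
  rw [Matrix.det_fin_two] at hdet
  ext i j
  fin_cases i <;> fin_cases j <;>
    simp [sq, Matrix.mul_apply, Fin.sum_univ_two] <;> grind

/-- For a domain `R`, the monoid `F₂ × ℕ` does not embed into `SL(2, R)`. -/
theorem Matrix.SpecialLinearGroup.not_injective_freeGroup_prod {R : Type*} [CommRing R]
    [IsDomain R]
    (φ : FreeGroup (Fin 2) × Multiplicative ℕ →* SpecialLinearGroup (Fin 2) R) :
    ¬ Function.Injective φ := by
  intro hφ
  let z : FreeGroup (Fin 2) × Multiplicative ℕ := (1, Multiplicative.ofAdd 1)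
  by_cases hz : φ z 0 0 = φ z 1 1 ∧ φ z 0 1 = 0 ∧ φ z 1 0 = 0
  · have h := sq_eq_one_of_scalar hz
    rw [← map_pow, ← map_one φ] at h
    have h' : Multiplicative.ofAdd 1 ^ 2 = (1 : Multiplicative ℕ) := congrArg Prod.snd (hφ h)
    exact absurd h' (by decide)
  · have hcomm (g : FreeGroup (Fin 2)) :
        (φ (g, 1)).val * (φ z).val = (φ z).val * (φ (g, 1)).val := by
      rw [← coe_mul, ← coe_mul, ← map_mul, ← map_mul]
      simp [z]
    have h : φ (FreeGroup.of 0, 1) * φ (FreeGroup.of 1, 1) =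
        φ (FreeGroup.of 1, 1) * φ (FreeGroup.of 0, 1) :=
      Subtype.ext (Matrix.commute_of_commute_nonscalar hz (hcomm _) (hcomm _))
    rw [← map_mul, ← map_mul] at h
    have h' : FreeGroup.of (0 : Fin 2) * FreeGroup.of 1 = FreeGroup.of 1 * FreeGroup.of 0 :=
      congrArg Prod.fst (hφ h)
    exact absurd (congrArg FreeGroup.toWord h') (by decide)

instance (d : ℕ) : IsDomain (Od d) :=
  inferInstanceAs (IsDomain (NumberField.RingOfIntegers (QuadField d)))

theorem stmt_17 (d : ℕ) (hd : d ∈ ({1, 2, 3, 7, 11} : Set ℕ)) :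
    ¬ ∃ φ : FreeGroup (Fin 2) × Multiplicative ℕ →*
        Matrix.SpecialLinearGroup (Fin 2) (Od d),
      Function.Injective φ := by
  rintro ⟨φ, hφ⟩
  exact Matrix.SpecialLinearGroup.not_injective_freeGroup_prod φ hφ
end

section
/- Let d ∈ {1, 2, 3, 7, 11} and let 𝒪_d be the ring of integers of the imaginary quadratic field ℚ(√−d), realized as a subfield of ℂ. Then there is no injective monoid homomorphism from (free monoid on two generators) × (free monoid on two generators) into the special linear group SL(3, 𝒪_d). -/
open Matrix

open Polynomial Module in
/-- The centralizer of a nonderogatory endomorphism is commutative. -/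
theorem Module.End.commute_of_natDegree_minpoly_eq_finrank {K V : Type*} [Field K]
    [AddCommGroup V] [Module K V] [FiniteDimensional K V] {f g h : Module.End K V}
    (hf : (minpoly K f).natDegree = Module.finrank K V) (hg : Commute f g) (hh : Commute f h) :
    Commute g h := by
  obtain ⟨x, hx⟩ := Module.exists_ker_toSpanSingleton_eq_annihilator K[X] (AEval' f)
  rw [← span_minpoly_eq_annihilator] at hx
  set v : V := (AEval'.of f).symm x with hv
  let L : degreeLT K (finrank K V) →ₗ[K] V :=
    (LinearMap.applyₗ v ∘ₗ (aeval f).toLinearMap) ∘ₗ (degreeLT K (finrank K V)).subtype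
  have hL : ∀ p, L p = aeval f (p : K[X]) v := fun p => rfl
  have hinj : Function.Injective L := by
    rw [injective_iff_map_eq_zero]
    rintro ⟨p, hp⟩ h0
    rw [hL] at h0
    have h1 : p ∈ LinearMap.ker (LinearMap.toSpanSingleton K[X] (AEval' f) x) := by
      rw [LinearMap.mem_ker, LinearMap.toSpanSingleton_apply]
      have : x = AEval'.of f v := by simp [hv]
      rw [this]
      exact (AEval.of_aeval_smul f p v).symm.trans (by simp [h0])
    rw [hx, Ideal.mem_span_singleton] at h1
    rw [mem_degreeLT, ← hf] at hp
    have : p = 0 := by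
      by_contra hne
      exact absurd (natDegree_le_of_dvd h1 hne) (by
        rw [not_le]; exact (natDegree_lt_iff_degree_lt hne).2 hp)
    simp [this]
  have hsurj : Function.Surjective L := by
    rw [← LinearMap.injective_iff_surjective_of_finrank_eq_finrank]
    · exact hinj
    · rw [(degreeLTEquiv K (finrank K V)).finrank_eq]; simp
  have hc : ∀ (p : K[X]) {a : Module.End K V}, Commute f a → Commute (aeval f p) a := by
    intro p a ha
    induction p using Polynomial.induction_on' with
    | add p q hp hq => simpa using hp.add_left hq
    | monomial n c =>
      rw [aeval_monomial]
      exact Commute.mul_left (Algebra.commutes c a) (ha.pow_left n)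
  have hcg := fun p => hc p hg
  have hch := fun p => hc p hh
  obtain ⟨p, hp⟩ := hsurj (g v)
  obtain ⟨q, hq⟩ := hsurj (h v)
  rw [hL] at hp hq
  refine LinearMap.ext fun y => ?_
  obtain ⟨r, rfl⟩ := hsurj y
  rw [hL]
  have e1 : ∀ p z, g (aeval f p z) = aeval f p (g z) := fun p z =>
    (LinearMap.congr_fun (hcg p) z).symm
  have e2 : ∀ p z, h (aeval f p z) = aeval f p (h z) := fun p z =>
    (LinearMap.congr_fun (hch p) z).symm
  simp only [Module.End.mul_apply, e1, e2, ← hp, ← hq]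
  simp only [← Module.End.mul_apply, ← map_mul]
  congr 3; ring

theorem Matrix.commute_of_natDegree_minpoly_eq_card {K n : Type*} [Field K] [Fintype n]
    [DecidableEq n] {X C D : Matrix n n K} (hX : (minpoly K X).natDegree = Fintype.card n)
    (hC : Commute X C) (hD : Commute X D) : Commute C D := by
  have h := Module.End.commute_of_natDegree_minpoly_eq_finrank (K := K)
    (f := toLinAlgEquiv' X) (g := toLinAlgEquiv' C) (h := toLinAlgEquiv' D)
    (by rw [minpoly.algEquiv_eq]; simpa using hX) (hC.map _) (hD.map _)
  exact (toLinAlgEquiv' : Matrix n n K ≃ₐ[K] _).injective (by simpa only [map_mul] using h.eq)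

theorem Matrix.exists_eq_vecMulVec_of_rank_le_one {K m n : Type*} [Field K] [Fintype n] [Finite m]
    [DecidableEq n] {M : Matrix m n K} (h : M.rank ≤ 1) : ∃ u v, M = vecMulVec u v := by
  obtain ⟨u, hu⟩ := finrank_le_one_iff.1 h
  choose c hc using fun j => hu ⟨M.mulVecLin (Pi.single j 1), LinearMap.mem_range_self _ _⟩
  refine ⟨u, c, ?_⟩
  ext i j
  have := congrFun (congrArg Subtype.val (hc j)) i
  simp at this
  simp [vecMulVec_apply, ← this, mul_comm]

open Polynomial in
/-- A `3 × 3` matrix commuting with two noncommuting matrices is a scalar plus a matrix of rank at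
most one. -/
theorem Matrix.exists_eq_scalar_add_vecMulVec {K : Type*} [Field K]
    {X C D : Matrix (Fin 3) (Fin 3) K} (hC : Commute X C) (hD : Commute X D)
    (hCD : ¬ Commute C D) : ∃ (l : K) (u v : Fin 3 → K), X = l • 1 + vecMulVec u v := by
  have hi : IsIntegral K X := Algebra.IsIntegral.isIntegral X
  have hdvd : minpoly K X ∣ X.charpoly := minpoly.dvd _ _ (aeval_self_charpoly X)
  have hdeg : X.charpoly.natDegree = 3 := by simp [charpoly_natDegree_eq_dim]
  have hne : X.charpoly ≠ 0 := (charpoly_monic X).ne_zero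
  have hm0 : minpoly K X ≠ 0 := minpoly.ne_zero hi
  have hlt : (minpoly K X).natDegree < 3 := by
    refine lt_of_le_of_ne ((natDegree_le_of_dvd hdvd hne).trans_eq hdeg) fun h => hCD ?_
    exact commute_of_natDegree_minpoly_eq_card (by simpa using h) hC hD
  have hroot : ∃ l, (minpoly K X).IsRoot l := by
    have hpos := minpoly.natDegree_pos hi
    obtain ⟨s, hs⟩ := hdvd
    have hs0 : s ≠ 0 := by rintro rfl; simp [hne] at hs
    have hadd := natDegree_mul hm0 hs0
    rw [← hs, hdeg] at hadd
    rcases (by omega : (minpoly K X).natDegree = 1 ∨ s.natDegree = 1) with h1 | h1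
    · exact exists_root_of_degree_eq_one (degree_eq_iff_natDegree_eq hm0 |>.2 h1)
    · obtain ⟨r, hr⟩ := exists_root_of_degree_eq_one (degree_eq_iff_natDegree_eq hs0 |>.2 h1)
      refine ⟨r, ?_⟩
      rw [← Matrix.minpoly_toLin', ← Module.End.hasEigenvalue_iff_isRoot,
        Module.End.hasEigenvalue_iff_isRoot_charpoly, Matrix.charpoly_toLin', hs]
      exact root_mul_left_of_isRoot _ hr
  obtain ⟨l, hl⟩ := hroot
  obtain ⟨q, hq⟩ := dvd_iff_isRoot.2 hl
  have hq0 : q ≠ 0 := by rintro rfl; simp [hm0] at hq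
  have hqd : q.natDegree ≤ 1 := by
    rw [hq, natDegree_mul (X_sub_C_ne_zero l) hq0, natDegree_X_sub_C] at hlt
    omega
  have hqX : (X - l • 1) * aeval X q = 0 := by
    have := minpoly.aeval K X
    rw [hq] at this
    simpa [Algebra.algebraMap_eq_smul_one] using this
  have hfin : ∀ c : K, (X - c • 1).rank ≤ 1 →
      ∃ (l : K) (u v : Fin 3 → K), X = l • 1 + vecMulVec u v := by
    intro c hc
    obtain ⟨u, v, h⟩ := exists_eq_vecMulVec_of_rank_le_one hc
    exact ⟨c, u, v, by rw [← h]; abel⟩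
  have hr := rank_add_rank_le_card_of_mul_eq_zero hqX
  rw [Fintype.card_fin] at hr
  obtain ⟨a, b, rfl⟩ := exists_eq_X_add_C_of_natDegree_le_one hqd
  by_cases ha : a = 0
  · subst ha
    have hb : b ≠ 0 := by rintro rfl; simp at hq0
    have : X - l • 1 = 0 := by simpa [hb, Algebra.algebraMap_eq_smul_one] using hqX
    exact hfin l (by simp [this])
  · rcases le_or_gt (X - l • 1).rank 1 with h | h
    · exact hfin l h
    · refine hfin (-(a⁻¹ * b)) ?_
      have e : X - (-(a⁻¹ * b)) • 1 =
          a⁻¹ • aeval X (Polynomial.C a * Polynomial.X + Polynomial.C b) := by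
        simp [Algebra.algebraMap_eq_smul_one, smul_smul, ha]
      rw [e, rank_smul_of_mem_nonZeroDivisors _
        (mem_nonZeroDivisors_of_ne_zero (inv_ne_zero ha))]
      omega

theorem Matrix.det_scalar_add_vecMulVec {R : Type*} [CommRing R] (l : R) (u v : Fin 3 → R) :
    (l • 1 + vecMulVec u v).det = l ^ 2 * (l + u ⬝ᵥ v) := by
  simp [det_fin_three, vecMulVec_apply, dotProduct, Fin.sum_univ_three]
  ring

theorem Matrix.trace_scalar_add_vecMulVec {R : Type*} [CommRing R] (l : R) (u v : Fin 3 → R) :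
    (l • 1 + vecMulVec u v).trace = 3 * l + u ⬝ᵥ v := by
  simp [trace_vecMulVec, mul_comm]

theorem Matrix.det_vecMulVec_add_vecMulVec {R : Type*} [CommRing R] (p q r s : Fin 3 → R) :
    (vecMulVec p q + vecMulVec r s).det = 0 := by
  simp [det_fin_three, vecMulVec_apply]
  ring

theorem Matrix.scalar_add_vecMulVec_pow {R n : Type*} [CommRing R] [Fintype n] [DecidableEq n]
    (l : R) (u v : n → R) (m : ℕ) : ∃ k : R,
      (l • 1 + vecMulVec u v) ^ m = l ^ m • 1 + k • vecMulVec u v ∧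
        (l + u ⬝ᵥ v) ^ m = l ^ m + k * (u ⬝ᵥ v) := by
  induction m with
  | zero => exact ⟨0, by simp⟩
  | succ m ih =>
    obtain ⟨k, h1, h2⟩ := ih
    refine ⟨l ^ m + k * l + k * (u ⬝ᵥ v), ?_, ?_⟩
    · rw [pow_succ, h1]
      simp only [add_mul, mul_add, smul_mul_assoc, mul_smul_comm, mul_one, one_mul,
        vecMulVec_mul_vecMulVec, smul_smul, dotProduct_comm v u, vecMulVec_smul, add_smul]
      module
    · rw [pow_succ, h2]
      ring

/-- Some power of a scalar plus a rank one matrix whose eigenvalues are roots of unity is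
a transvection. -/
theorem Matrix.exists_pow_eq_one_add_vecMulVec {R n : Type*} [CommRing R] [Fintype n]
    [DecidableEq n] {l : R} {u v : n → R} {m : ℕ} (hl : l ^ m = 1) (hm : (l + u ⬝ᵥ v) ^ m = 1) :
    ∃ w : n → R, (l • 1 + vecMulVec u v) ^ m = 1 + vecMulVec w v ∧ w ⬝ᵥ v = 0 := by
  obtain ⟨k, h1, h2⟩ := scalar_add_vecMulVec_pow l u v m
  refine ⟨k • u, by rw [h1, hl, one_smul, smul_vecMulVec], ?_⟩
  rw [hl, hm] at h2
  rw [smul_dotProduct, smul_eq_mul]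
  linear_combination -h2

/-- Two rank one square-zero matrices commute if their sum is a scalar plus a rank one matrix. -/
theorem Matrix.commute_vecMulVec_of_add_eq {K : Type*} [Field K] (h2 : (2 : K) ≠ 0)
    {p q r s e f : Fin 3 → K} {l : K} (hp : p ⬝ᵥ q = 0) (hr : r ⬝ᵥ s = 0)
    (h : vecMulVec p q + vecMulVec r s = l • 1 + vecMulVec e f) :
    Commute (vecMulVec p q) (vecMulVec r s) := by
  have htr := congrArg trace h
  have hdet := congrArg det h
  rw [trace_add, trace_vecMulVec, trace_vecMulVec, hp, hr, trace_scalar_add_vecMulVec] at htr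
  rw [det_vecMulVec_add_vecMulVec, det_scalar_add_vecMulVec] at hdet
  have hl : l = 0 := by
    have : 2 * l ^ 3 = 0 := by linear_combination hdet - l ^ 2 * htr
    simpa [h2] using this
  subst hl
  have hef : e ⬝ᵥ f = 0 := by linear_combination -htr
  rw [zero_smul, zero_add] at h
  have hsq : vecMulVec p q * vecMulVec r s + vecMulVec r s * vecMulVec p q = 0 := by
    have hs : (vecMulVec p q + vecMulVec r s) * (vecMulVec p q + vecMulVec r s) = 0 := by
      rw [h, vecMulVec_mul_vecMulVec, dotProduct_comm, hef]; simp
    rw [add_mul, mul_add, mul_add, vecMulVec_mul_vecMulVec p q p q,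
      vecMulVec_mul_vecMulVec r s r s, dotProduct_comm q, dotProduct_comm s, hp, hr] at hs
    simpa using hs
  have hpr : vecMulVec p q * vecMulVec r s = 0 ∨ vecMulVec r s * vecMulVec p q = 0 := by
    have ht := congrArg trace hsq
    rw [trace_add, trace_mul_comm (vecMulVec r s), vecMulVec_mul_vecMulVec, trace_vecMulVec,
      dotProduct_smul, trace_zero, smul_eq_mul, ← two_mul] at ht
    rw [vecMulVec_mul_vecMulVec, vecMulVec_mul_vecMulVec, dotProduct_comm s p]
    rcases mul_eq_zero.1 ((mul_eq_zero.1 ht).resolve_left h2) with h0 | h0 <;> simp [h0]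
  rcases hpr with h0 | h0 <;> simp only [h0, zero_add, add_zero] at hsq <;>
    simp [commute_iff_eq, h0, hsq]

theorem Matrix.exists_commute_pow {K : Type*} [Field K] [CharZero K]
    {A B C D : Matrix (Fin 3) (Fin 3) K} (hAC : Commute A C) (hAD : Commute A D)
    (hBC : Commute B C) (hBD : Commute B D) (hCD : ¬ Commute C D)
    (hA : ∀ l u v, A = l • 1 + vecMulVec u v → ∃ n, 0 < n ∧ l ^ n = 1 ∧ (l + u ⬝ᵥ v) ^ n = 1)
    (hB : ∀ l u v, B = l • 1 + vecMulVec u v → ∃ n, 0 < n ∧ l ^ n = 1 ∧ (l + u ⬝ᵥ v) ^ n = 1) :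
    ∃ m n, 0 < m ∧ 0 < n ∧ Commute (A ^ m) (B ^ n) := by
  obtain ⟨a, u, v, rfl⟩ := exists_eq_scalar_add_vecMulVec hAC hAD hCD
  obtain ⟨b, w, z, rfl⟩ := exists_eq_scalar_add_vecMulVec hBC hBD hCD
  obtain ⟨m, hm, ham, ham'⟩ := hA _ _ _ rfl
  obtain ⟨n, hn, hbn, hbn'⟩ := hB _ _ _ rfl
  obtain ⟨p, hp, hpv⟩ := exists_pow_eq_one_add_vecMulVec ham ham'
  obtain ⟨r, hr, hrz⟩ := exists_pow_eq_one_add_vecMulVec hbn hbn'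
  have key : ∀ E, Commute (a • 1 + vecMulVec u v) E → Commute (b • 1 + vecMulVec w z) E →
      Commute (vecMulVec p v + vecMulVec r z) E := by
    intro E h1 h2
    have h1 := h1.pow_left m
    have h2 := h2.pow_left n
    rw [hp] at h1
    rw [hr] at h2
    have hsum : vecMulVec p v + vecMulVec r z =
        1 + vecMulVec p v + (1 + vecMulVec r z) - 1 - 1 := by abel
    rw [hsum]
    exact ((h1.add_left h2).sub_left (Commute.one_left E)).sub_left (Commute.one_left E)
  obtain ⟨l, e, f, h⟩ := exists_eq_scalar_add_vecMulVec (key C hAC hBC) (key D hAD hBD) hCD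
  refine ⟨m, n, hm, hn, ?_⟩
  rw [hp, hr]
  have := commute_vecMulVec_of_add_eq two_ne_zero hpv hrz h
  exact ((Commute.one_left _).add_left
    ((Commute.one_right _).add_right this))

open NumberField in
theorem Matrix.SpecialLinearGroup.exists_pow_eq_one_of_eq_scalar_add_vecMulVec
    {K : Type*} [Field K] [NumberField K]
    (hU : ∀ x : (𝓞 K)ˣ, ∃ n, 0 < n ∧ x ^ n = 1) (A : SpecialLinearGroup (Fin 3) (𝓞 K))
    {l : K} {u v : Fin 3 → K}
    (h : (A.1.map (algebraMap (𝓞 K) K)) = l • 1 + vecMulVec u v) :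
    ∃ n, 0 < n ∧ l ^ n = 1 ∧ (l + u ⬝ᵥ v) ^ n = 1 := by
  have hdet : l ^ 2 * (l + u ⬝ᵥ v) = 1 := by
    rw [← det_scalar_add_vecMulVec, ← h, ← RingHom.mapMatrix_apply, ← RingHom.map_det, A.2,
      map_one]
  have htr : 3 * l + u ⬝ᵥ v = algebraMap (𝓞 K) K A.1.trace := by
    rw [← trace_scalar_add_vecMulVec, ← h, AddMonoidHom.map_trace]
  have hl : IsIntegral (𝓞 K) l := by
    refine ⟨A.1.charpoly, charpoly_monic _, ?_⟩
    rw [← Polynomial.eval_map, ← charpoly_map, h, eval_charpoly]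
    have : scalar (Fin 3) l - (l • 1 + vecMulVec u v) = (0 : K) • 1 + vecMulVec (-u) v := by
      ext i j; simp [Matrix.scalar_apply, ← smul_one_eq_diagonal]
    rw [this, det_scalar_add_vecMulVec]
    simp
  obtain ⟨x, rfl⟩ := (IsIntegrallyClosed.isIntegral_iff (R := 𝓞 K)).1 hl
  set y : 𝓞 K := A.1.trace - 2 * x with hy
  have hy' : algebraMap (𝓞 K) K x + u ⬝ᵥ v = algebraMap (𝓞 K) K y := by
    rw [hy, map_sub, ← htr, map_mul, map_ofNat]
    ring
  rw [hy'] at hdet ⊢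
  have hxy : x ^ 2 * y = 1 := by
    apply FaithfulSMul.algebraMap_injective (𝓞 K) K
    simpa using hdet
  obtain ⟨m, hm, hxm⟩ := hU (Units.mkOfMulEqOne x (x * y) (by rw [← hxy]; ring))
  obtain ⟨n, hn, hyn⟩ := hU (Units.mkOfMulEqOne y (x ^ 2) (by rw [← hxy]; ring))
  have hxm' : x ^ m = 1 := congrArg Units.val hxm
  have hyn' : y ^ n = 1 := congrArg Units.val hyn
  refine ⟨m * n, Nat.mul_pos hm hn, ?_, ?_⟩
  · rw [← map_pow, pow_mul, hxm', one_pow, map_one]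
  · rw [← map_pow, mul_comm m, pow_mul, hyn', one_pow, map_one]

theorem FreeMonoid.not_commute_of_pow {α : Type*} {x y : α} (hxy : x ≠ y) {m n : ℕ}
    (hm : 0 < m) (hn : 0 < n) : ¬ Commute (of x ^ m) (of y ^ n) := by
  intro h
  obtain ⟨m, rfl⟩ := Nat.exists_eq_add_one.2 hm
  obtain ⟨n, rfl⟩ := Nat.exists_eq_add_one.2 hn
  have := congrArg (fun w => (toList w).head?) h.eq
  simp [pow_succ', mul_assoc, toList_mul, hxy] at this

open NumberField in
theorem Matrix.SpecialLinearGroup.not_injective_of_freeMonoid_prod {K : Type*} [Field K]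
    [NumberField K] (hU : ∀ x : (𝓞 K)ˣ, ∃ n, 0 < n ∧ x ^ n = 1)
    (φ : FreeMonoid (Fin 2) × FreeMonoid (Fin 2) →* SpecialLinearGroup (Fin 3) (𝓞 K)) :
    ¬ Function.Injective φ := by
  intro hφ
  let ψ : SpecialLinearGroup (Fin 3) (𝓞 K) →* Matrix (Fin 3) (Fin 3) K :=
    coeMonoidHom.comp (map (algebraMap (𝓞 K) K))
  have hψ : Function.Injective ψ :=
    (Matrix.map_injective (FaithfulSMul.algebraMap_injective (𝓞 K) K)).comp
      coeMonoidHom_injective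
  let χ := ψ.comp φ
  have hχ : ∀ x y, Commute (χ x) (χ y) → Commute x y := fun x y h =>
    hφ (hψ (by simpa only [χ, MonoidHom.comp_apply, map_mul] using h.eq))
  have hcomm : ∀ x y : FreeMonoid (Fin 2), Commute (χ (x, 1)) (χ (1, y)) := fun x y =>
    Commute.map (Prod.ext (by simp) (by simp)) χ
  have hroot : ∀ x l u v, χ x = l • 1 + vecMulVec u v →
      ∃ n, 0 < n ∧ l ^ n = 1 ∧ (l + u ⬝ᵥ v) ^ n = 1 := fun x _ _ _ h =>
    exists_pow_eq_one_of_eq_scalar_add_vecMulVec hU (φ x) h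
  let a : FreeMonoid (Fin 2) := FreeMonoid.of 0
  let b : FreeMonoid (Fin 2) := FreeMonoid.of 1
  have hab : ∀ {m n : ℕ}, 0 < m → 0 < n → ¬ Commute (a ^ m) (b ^ n) :=
    FreeMonoid.not_commute_of_pow (by decide)
  obtain ⟨m, n, hm, hn, h⟩ := exists_commute_pow (hcomm a a) (hcomm a b) (hcomm b a) (hcomm b b)
    (fun h => by
      have := (hχ _ _ h).map (MonoidHom.snd _ _)
      exact hab one_pos one_pos (by simpa using this)) (hroot _) (hroot _)
  rw [← map_pow, ← map_pow] at h
  exact hab hm hn (by simpa using (hχ _ _ h).map (MonoidHom.fst _ _))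

theorem QuadField.generator_mem (d : ℕ) : (Real.sqrt d : ℂ) * Complex.I ∈ QuadField d :=
  IntermediateField.mem_adjoin_simple_self ℚ _

theorem QuadField.generator_sq (d : ℕ) : ((Real.sqrt d : ℂ) * Complex.I) ^ 2 = -d := by
  rw [mul_pow, Complex.I_sq, ← Complex.ofReal_pow, Real.sq_sqrt d.cast_nonneg]
  simp

instance (d : ℕ) : NumberField (QuadField d) where
  to_charZero := inferInstance
  to_finiteDimensional := by
    refine IntermediateField.adjoin.finiteDimensional (IsIntegral.of_pow two_pos ?_)
    rw [QuadField.generator_sq]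
    simpa using isIntegral_algebraMap (R := ℚ) (A := ℂ) (x := -(d : ℚ))

theorem QuadField.norm_embedding (d : ℕ) (φ : QuadField d →+* ℂ) (x : QuadField d) :
    ‖φ x‖ = ‖(x : ℂ)‖ := by
  set s : QuadField d := ⟨_, generator_mem d⟩
  have hs : s ^ 2 = -(d : QuadField d) := Subtype.ext (by simpa [s] using generator_sq d)
  have hext : ∀ ψ : QuadField d →+* ℂ, φ s = ψ s → φ = ψ := by
    intro ψ h
    have : φ.toRatAlgHom = ψ.toRatAlgHom := by
      refine IntermediateField.algHom_ext_of_eq_adjoin (S := QuadField d) ℚ rfl ?_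
      rintro x (rfl : x = _)
      exact h
    exact RingHom.ext fun x => DFunLike.congr_fun this x
  have h2 : φ s ^ 2 = (s : ℂ) ^ 2 := by
    rw [← map_pow, hs]
    simp [s, generator_sq]
  rcases sq_eq_sq_iff_eq_or_eq_neg.1 h2 with h | h
  · rw [hext (algebraMap (QuadField d) ℂ) h]
    rfl
  · rw [hext ((starRingEnd ℂ).comp (algebraMap (QuadField d) ℂ)) ?_]
    · exact Complex.norm_conj _
    · rw [h]
      simp [s, IntermediateField.algebraMap_apply]

open NumberField in
theorem QuadField.exists_pow_eq_one (d : ℕ) (x : (𝓞 (QuadField d))ˣ) :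
    ∃ n, 0 < n ∧ x ^ n = 1 := by
  have hx : ‖((x : 𝓞 (QuadField d)) : ℂ)‖ = 1 := by
    have h := InfinitePlace.prod_eq_abs_norm ((x : 𝓞 (QuadField d)) : QuadField d)
    rw [Units.norm] at h
    have hw : ∀ w : InfinitePlace (QuadField d),
        w ((x : 𝓞 (QuadField d)) : QuadField d) = ‖((x : 𝓞 (QuadField d)) : ℂ)‖ := fun w => by
      rw [← InfinitePlace.norm_embedding_eq, norm_embedding]
    simp only [hw, Finset.prod_pow_eq_pow_sum, InfinitePlace.sum_mult_eq, Rat.cast_one] at h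
    exact (pow_eq_one_iff_of_nonneg (norm_nonneg _) Module.finrank_pos.ne').1 h
  obtain ⟨n, hn, h⟩ := Embeddings.pow_eq_one_of_norm_eq_one (QuadField d) ℂ
    x.val.isIntegral_coe fun φ => (norm_embedding d φ _).trans hx
  refine ⟨n, hn, Units.ext (RingOfIntegers.ext ?_)⟩
  simpa using h

theorem stmt_18 (d : ℕ) (hd : d ∈ ({1, 2, 3, 7, 11} : Set ℕ)) :
    ¬ ∃ φ : FreeMonoid (Fin 2) × FreeMonoid (Fin 2) →*
        Matrix.SpecialLinearGroup (Fin 3) (Od d),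
      Function.Injective φ := by
  rintro ⟨φ, hφ⟩
  exact Matrix.SpecialLinearGroup.not_injective_of_freeMonoid_prod
    (QuadField.exists_pow_eq_one d) φ hφ
end

section
/- Let d ∈ {1, 2, 3, 7, 11} and let 𝒪_d be the ring of integers of the imaginary quadratic field ℚ(√−d), realized as a subfield of ℂ. Then there is no injective monoid homomorphism from (free group on two generators) × (free monoid on two generators) into the multiplicative monoid of 3×3 matrices over 𝒪_d. -/
open Matrix

open Polynomial in
/-- An endomorphism of a finite-dimensional space over an algebraically closed field admits a vector
whose annihilating polynomials all annihilate the endomorphism. -/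
theorem exists_vector_aeval_eq_zero {K V : Type*} [Field K] [IsAlgClosed K] [AddCommGroup V]
    [Module K V] [FiniteDimensional K V] (f : Module.End K V) :
    ∃ v : V, ∀ p : K[X], aeval f p v = 0 → aeval f p = 0 := by
  classical
  have hm0 : minpoly K f ≠ 0 := minpoly.ne_zero (Algebra.IsIntegral.isIntegral f)
  set S : Finset (Submodule K V) := (minpoly K f).roots.toFinset.image
    fun c => LinearMap.ker (aeval f (minpoly K f /ₘ (X - C c))) with hS
  have hroot : ∀ c ∈ (minpoly K f).roots,
      (X - C c) * (minpoly K f /ₘ (X - C c)) = minpoly K f := fun c hc =>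
    mul_divByMonic_eq_iff_isRoot.2 (isRoot_of_mem_roots hc)
  have htop : ⊤ ∉ S := by
    intro h
    simp only [hS, Finset.mem_image, Multiset.mem_toFinset] at h
    obtain ⟨c, hc, h⟩ := h
    have hdvd := minpoly.dvd K f (LinearMap.ker_eq_top.1 h)
    have hq0 : minpoly K f /ₘ (X - C c) ≠ 0 := by
      intro h0
      exact hm0 (by rw [← hroot c hc, h0, mul_zero])
    have h1 := natDegree_le_of_dvd hdvd hq0
    have h2 := congrArg natDegree (hroot c hc)
    rw [natDegree_mul (X_sub_C_ne_zero c) hq0, natDegree_X_sub_C] at h2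
    omega
  have hcov := Subspace.biUnion_ne_univ_of_top_notMem htop
  obtain ⟨v, hv⟩ := (Set.ne_univ_iff_exists_notMem _).1 hcov
  refine ⟨v, fun p hp => ?_⟩
  by_contra hpf
  obtain ⟨d, hd⟩ := (IsPrincipalIdealRing.principal (Ideal.span {p, minpoly K f})).principal
  have hdmem : d ∈ Ideal.span {p, minpoly K f} := by
    rw [hd]; exact Submodule.mem_span_singleton_self d
  have hdvd : ∀ x ∈ Ideal.span {p, minpoly K f}, d ∣ x := by
    intro x hx
    rw [hd] at hx
    exact Ideal.mem_span_singleton.1 hx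
  have hdp : d ∣ p := hdvd p (Ideal.subset_span (by simp))
  obtain ⟨e, he⟩ : d ∣ minpoly K f := hdvd _ (Ideal.subset_span (by simp))
  obtain ⟨x, y, hxy⟩ := Ideal.mem_span_pair.1 hdmem
  have hdv : aeval f d v = 0 := by
    rw [← hxy]
    simp [hp]
  have hdeg : e.degree ≠ 0 := by
    intro h0
    obtain ⟨u, hu⟩ := isUnit_iff_degree_eq_zero.2 h0
    have hmd : minpoly K f ∣ d := by
      rw [he, ← hu]
      exact (Units.mul_right_dvd).2 dvd_rfl
    exact hpf ((minpoly.dvd_iff).1 (hmd.trans hdp))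
  obtain ⟨c, hc⟩ := IsAlgClosed.exists_root e hdeg
  obtain ⟨e', he'⟩ := dvd_iff_isRoot.2 hc
  have hcm : c ∈ (minpoly K f).roots := by
    rw [mem_roots hm0, he, IsRoot, eval_mul, hc.eq_zero, mul_zero]
  have hq : minpoly K f /ₘ (X - C c) = e' * d := by
    apply mul_left_cancel₀ (X_sub_C_ne_zero c)
    rw [hroot c hcm, he, he']
    ring
  apply hv
  simp only [hS, Finset.mem_image, Multiset.mem_toFinset, Set.mem_iUnion]
  refine ⟨_, ⟨c, hcm, rfl⟩, ?_⟩
  simp [hq, hdv]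

open Polynomial in
/-- On a three-dimensional space, an endomorphism with noncommutative centralizer differs from a
scalar by an endomorphism of rank at most one. -/
theorem exists_finrank_range_sub_algebraMap_le_one {K V : Type*} [Field K] [IsAlgClosed K]
    [AddCommGroup V] [Module K V] [FiniteDimensional K V] (hV : Module.finrank K V = 3)
    {f a b : Module.End K V} (ha : Commute a f) (hb : Commute b f) (hab : ¬ Commute a b) :
    ∃ c : K, Module.finrank K (LinearMap.range (f - algebraMap K (Module.End K V) c)) ≤ 1 := by
  have : Nontrivial V := Module.nontrivial_of_finrank_pos (R := K) (by omega)
  obtain ⟨v, hv⟩ := exists_vector_aeval_eq_zero f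
  have hint : IsIntegral K f := Algebra.IsIntegral.isIntegral f
  have hcomm : ∀ {g : Module.End K V}, Commute g f → ∀ p : K[X], ∀ w,
      g (aeval f p w) = aeval f p (g w) := by
    intro g hg p w
    have : Commute g (aeval f p) := by
      induction p using Polynomial.induction_on' with
      | add p q hp hq => rw [map_add]; exact hp.add_right hq
      | monomial n r =>
        rw [aeval_monomial]
        exact (Algebra.commute_algebraMap_right r g).mul_right (hg.pow_right n)
    exact LinearMap.congr_fun this.eq w
  by_cases hdeg : 3 ≤ (minpoly K f).natDegree
  · exfalso
    let T : degreeLT K 3 →ₗ[K] V :=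
      (LinearMap.applyₗ v ∘ₗ (aeval f).toLinearMap) ∘ₗ (degreeLT K 3).subtype
    have hT : Function.Injective T := by
      rw [← LinearMap.ker_eq_bot, LinearMap.ker_eq_bot']
      rintro ⟨p, hp⟩ h
      have h1 : aeval f p = 0 := hv p h
      have h2 := minpoly.dvd K f h1
      rw [Subtype.ext_iff]
      by_contra hp0
      have h3 : (minpoly K f).natDegree ≤ p.natDegree := natDegree_le_of_dvd h2 hp0
      have h4 : p.natDegree < 3 := (natDegree_lt_iff_degree_lt hp0).2 (mem_degreeLT.1 hp)
      omega
    have hfin : Module.finrank K (degreeLT K 3) = Module.finrank K V := by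
      rw [hV, (degreeLTEquiv K 3).finrank_eq]; simp
    have : FiniteDimensional K (degreeLT K 3) :=
      (degreeLTEquiv K 3).symm.finiteDimensional
    have hsurj := (LinearMap.injective_iff_surjective_of_finrank_eq_finrank hfin).1 hT
    have hex : ∀ w, ∃ p : K[X], aeval f p v = w := fun w =>
      let ⟨p, hp⟩ := hsurj w
      ⟨p, hp⟩
    obtain ⟨p, hp⟩ := hex (a v)
    obtain ⟨r, hr⟩ := hex (b v)
    apply hab
    refine LinearMap.ext fun w => ?_
    obtain ⟨q, rfl⟩ := hex w
    rw [Module.End.mul_apply, Module.End.mul_apply, hcomm hb, hcomm ha, hcomm ha, hcomm hb,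
      ← hr, ← hp, hcomm ha, hcomm hb, ← hr, ← hp]
    simp only [← Module.End.mul_apply, ← map_mul]
    rw [mul_comm r p]
  · obtain ⟨c, hc⟩ := IsAlgClosed.exists_root (minpoly K f) (minpoly.degree_pos hint).ne'
    obtain ⟨q, hq⟩ := dvd_iff_isRoot.2 hc
    have hqm : q.Monic := (monic_X_sub_C c).of_mul_monic_left (hq ▸ minpoly.monic hint)
    have hqd : q.natDegree ≤ 1 := by
      have := congrArg natDegree hq
      rw [(monic_X_sub_C c).natDegree_mul hqm, natDegree_X_sub_C] at this
      omega
    have hz := minpoly.aeval K f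
    rw [hq, map_mul] at hz
    have hX : ∀ t : K, aeval f (X - C t) = f - algebraMap K (Module.End K V) t := by simp
    rw [hX] at hz
    rcases Nat.le_one_iff_eq_zero_or_eq_one.1 hqd with h0 | h1
    · rw [hqm.natDegree_eq_zero.1 h0, map_one, mul_one] at hz
      exact ⟨c, by rw [hz, LinearMap.range_zero, finrank_bot]; exact zero_le_one⟩
    · have hq' : q = X - C (-q.coeff 0) := by
        rw [map_neg, sub_neg_eq_add]
        exact hqm.eq_X_add_C h1
      rw [hq', hX] at hz
      set t := -q.coeff 0
      by_contra! hcon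
      have h2 := hcon c
      have h3 := hcon t
      have hle : LinearMap.range (f - algebraMap K (Module.End K V) t) ≤
          LinearMap.ker (f - algebraMap K (Module.End K V) c) := LinearMap.range_le_ker_iff.2 hz
      have h4 := Submodule.finrank_mono hle
      have h5 := LinearMap.finrank_range_add_finrank_ker (f - algebraMap K (Module.End K V) c)
      omega

/-- A `3 × 3` matrix with noncommutative centralizer is the sum of a scalar matrix and an outer
product. -/
theorem exists_eq_scalar_add_vecMulVec {K : Type*} [Field K] [IsAlgClosed K]
    {M A B : Matrix (Fin 3) (Fin 3) K} (hA : Commute A M) (hB : Commute B M)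
    (hAB : ¬ Commute A B) :
    ∃ (c : K) (p q : Fin 3 → K), M = algebraMap K _ c + vecMulVec p q := by
  have hAB' : ¬ Commute (toLinAlgEquiv' A) (toLinAlgEquiv' B) := fun h => hAB <|
    toLinAlgEquiv'.injective (by simpa only [map_mul] using h.eq)
  obtain ⟨c, hc⟩ := exists_finrank_range_sub_algebraMap_le_one (by simp)
    (hA.map toLinAlgEquiv') (hB.map toLinAlgEquiv') hAB'
  obtain ⟨p, hp⟩ := finrank_le_one_iff.1 hc
  have hcol : ∀ j, ∃ t : K, t • (p : Fin 3 → K) = (M - algebraMap K _ c) *ᵥ Pi.single j 1 := by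
    intro j
    have hmem : (M - algebraMap K _ c) *ᵥ Pi.single j 1 ∈ LinearMap.range
        (toLinAlgEquiv' M - algebraMap K (Module.End K (Fin 3 → K)) c) := by
      refine ⟨Pi.single j 1, ?_⟩
      rw [← AlgEquiv.commutes toLinAlgEquiv' c, ← map_sub, toLinAlgEquiv'_apply]
    obtain ⟨t, ht⟩ := hp ⟨_, hmem⟩
    exact ⟨t, congrArg Subtype.val ht⟩
  choose q hq using hcol
  refine ⟨c, p, q, ?_⟩
  rw [← sub_eq_iff_eq_add']
  ext i j
  have := congrFun (hq j) i
  rw [mulVec_single_one] at this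
  simpa [vecMulVec_apply, mul_comm] using this.symm

/-- Matrices of determinant one fixing the first two basis vectors commute. -/
theorem commute_of_mulVec_single_eq {K : Type*} [Field K] {A B : Matrix (Fin 3) (Fin 3) K}
    (hA : A.det = 1) (hB : B.det = 1)
    (hA0 : A.col 0 = Pi.single 0 1) (hA1 : A.col 1 = Pi.single 1 1)
    (hB0 : B.col 0 = Pi.single 0 1) (hB1 : B.col 1 = Pi.single 1 1) : Commute A B := by
  have a := congrFun hA0
  have a' := congrFun hA1
  have b := congrFun hB0
  have b' := congrFun hB1
  simp only [Fin.forall_fin_succ, Matrix.col_apply] at a a' b b'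
  simp at a a' b b'
  rw [det_fin_three] at hA hB
  simp [a, a'] at hA
  simp [b, b'] at hB
  refine Matrix.ext fun i j => ?_
  fin_cases i <;> fin_cases j <;> simp [Matrix.mul_apply, Fin.sum_univ_three, a, a', b, b', hA, hB,
    add_comm]

/-- Two matrices of determinant one fixing the same two independent vectors commute. -/
theorem commute_of_mulVec_eq_self {K : Type*} [Field K] {A B : Matrix (Fin 3) (Fin 3) K}
    (hA : A.det = 1) (hB : B.det = 1) {p r : Fin 3 → K} (hpr : LinearIndependent K ![p, r])
    (hAp : A *ᵥ p = p) (hAr : A *ᵥ r = r) (hBp : B *ᵥ p = p) (hBr : B *ᵥ r = r) :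
    Commute A B := by
  obtain ⟨w, hw⟩ := exists_linearIndependent_snoc_of_lt_finrank hpr (by simp)
  set P : Matrix (Fin 3) (Fin 3) K := (Matrix.of (Fin.snoc ![p, r] w : Fin 3 → Fin 3 → K))ᵀ with hP
  have hPu : IsUnit P := by
    rw [← linearIndependent_cols_iff_isUnit]
    exact hw
  have hP0 : P.col 0 = p := rfl
  have hP1 : P.col 1 = r := rfl
  obtain ⟨u, hu⟩ := hPu
  have key : ∀ {C : Matrix (Fin 3) (Fin 3) K} {x : Fin 3 → K} {j : Fin 3}, P.col j = x →
      C *ᵥ x = x → ((u⁻¹).val * C * P).col j = Pi.single j 1 := by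
    intro C x j hj hx
    rw [← mulVec_single_one, ← mulVec_mulVec, mulVec_single_one, hj, ← mulVec_mulVec, hx, ← hj,
      ← mulVec_single_one, mulVec_mulVec, ← hu, Units.inv_mul, one_mulVec]
  have hdet : ∀ {C : Matrix (Fin 3) (Fin 3) K}, C.det = 1 → ((u⁻¹).val * C * P).det = 1 := by
    intro C hC
    rw [det_mul, det_mul, hC, mul_one, ← det_mul, ← hu, Units.inv_mul, det_one]
  have h := commute_of_mulVec_single_eq (hdet hA) (hdet hB) (key hP0 hAp) (key hP1 hAr)
    (key hP0 hBp) (key hP1 hBr)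
  have hconj : (u⁻¹).val * (A * B) * P = (u⁻¹).val * (B * A) * P := by
    have := h.eq
    simp only [← hu, mul_assoc, Units.mul_inv_cancel_left] at this ⊢
    exact this
  rw [← hu] at hconj
  exact (Units.mul_right_inj _).1 ((Units.mul_left_inj _).1 hconj)

/-- Matrices of determinant one that fix, under left and right multiplication, two noncommuting
outer products commute with each other. -/
theorem commute_of_mul_vecMulVec_eq {K : Type*} [Field K] {A B : Matrix (Fin 3) (Fin 3) K}
    (hA : A.det = 1) (hB : B.det = 1) {p q r s : Fin 3 → K}
    (hne : ¬ Commute (vecMulVec p q) (vecMulVec r s))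
    (hAX : A * vecMulVec p q = vecMulVec p q) (hXA : vecMulVec p q * A = vecMulVec p q)
    (hAY : A * vecMulVec r s = vecMulVec r s) (hYA : vecMulVec r s * A = vecMulVec r s)
    (hBX : B * vecMulVec p q = vecMulVec p q) (hXB : vecMulVec p q * B = vecMulVec p q)
    (hBY : B * vecMulVec r s = vecMulVec r s) (hYB : vecMulVec r s * B = vecMulVec r s) :
    Commute A B := by
  have hp : p ≠ 0 := by rintro rfl; simp at hne
  have hq : q ≠ 0 := by rintro rfl; simp at hne
  have hr : r ≠ 0 := by rintro rfl; simp at hne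
  have hs : s ≠ 0 := by rintro rfl; simp at hne
  have left : ∀ {C : Matrix (Fin 3) (Fin 3) K} {x y : Fin 3 → K}, y ≠ 0 →
      C * vecMulVec x y = vecMulVec x y → C *ᵥ x = x := by
    intro C x y hy h
    obtain ⟨j, hj⟩ := Function.ne_iff.1 hy
    rw [mul_vecMulVec] at h
    ext i
    exact mul_right_cancel₀ hj (congrFun (congrFun h i) j)
  have right : ∀ {C : Matrix (Fin 3) (Fin 3) K} {x y : Fin 3 → K}, x ≠ 0 →
      vecMulVec x y * C = vecMulVec x y → Cᵀ *ᵥ y = y := by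
    intro C x y hx h
    obtain ⟨j, hj⟩ := Function.ne_iff.1 hx
    rw [vecMulVec_mul, ← mulVec_transpose] at h
    ext i
    exact mul_left_cancel₀ hj (congrFun (congrFun h j) i)
  by_cases hpr : LinearIndependent K ![p, r]
  · exact commute_of_mulVec_eq_self hA hB hpr (left hq hAX) (left hs hAY) (left hq hBX)
      (left hs hBY)
  by_cases hqs : LinearIndependent K ![q, s]
  · have h := commute_of_mulVec_eq_self ((det_transpose A).trans hA) ((det_transpose B).trans hB)
      hqs (right hp hXA) (right hr hYA) (right hp hXB) (right hr hYB)
    have h' := congrArg transpose h.eq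
    rw [transpose_mul, transpose_mul, transpose_transpose, transpose_transpose] at h'
    exact h'.symm
  exfalso
  rw [LinearIndependent.pair_iff' hp] at hpr
  rw [LinearIndependent.pair_iff' hq] at hqs
  push Not at hpr hqs
  obtain ⟨a, rfl⟩ := hpr
  obtain ⟨b, rfl⟩ := hqs
  apply hne
  rw [smul_vecMulVec, vecMulVec_smul]
  exact ((Commute.refl _).smul_right b).smul_right a

open scoped commutatorElement in
/-- A group acting on a three-dimensional space and commuting with two noncommuting matrices
is metabelian. -/
theorem commute_map_commutatorElement {K G : Type*} [Field K] [IsAlgClosed K] [Group G]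
    (ψ : G →* Matrix (Fin 3) (Fin 3) K) {X Y : Matrix (Fin 3) (Fin 3) K}
    (hX : ∀ g, Commute (ψ g) X) (hY : ∀ g, Commute (ψ g) Y) (hXY : ¬ Commute X Y) (a b c d : G) :
    Commute (ψ ⁅a, b⁆) (ψ ⁅c, d⁆) := by
  by_contra hne
  obtain ⟨x, p, q, rfl⟩ := exists_eq_scalar_add_vecMulVec (hX _) (hX _) hne
  obtain ⟨y, r, s, rfl⟩ := exists_eq_scalar_add_vecMulVec (hY _) (hY _) hne
  have hXv : ∀ g, Commute (ψ g) (vecMulVec p q) := fun g => by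
    simpa using (hX g).sub_right (Algebra.commute_algebraMap_right x (ψ g))
  have hYv : ∀ g, Commute (ψ g) (vecMulVec r s) := fun g => by
    simpa using (hY g).sub_right (Algebra.commute_algebraMap_right y (ψ g))
  have hXY' : ¬ Commute (vecMulVec p q) (vecMulVec r s) := fun h => hXY <|
    (Algebra.commute_algebraMap_left x _).add_left
      ((Algebra.commute_algebraMap_right y (vecMulVec p q)).add_right h)
  have hdet : ∀ g h : G, (ψ ⁅g, h⁆).det = 1 := by
    intro g h
    have hu := map_commutatorElement ((Units.map detMonoidHom).comp ψ.toHomUnits) g h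
    exact congrArg Units.val
      (hu.trans (commutatorElement_eq_one_iff_mul_comm.2 (mul_comm _ _)))
  have hscal : ∀ {u v : Fin 3 → K}, (∀ g, Commute (ψ g) (vecMulVec u v)) → ∀ g,
      ∃ t : K, ψ g * vecMulVec u v = t • vecMulVec u v := by
    intro u v h g
    by_cases hv : v = 0
    · exact ⟨0, by simp [hv]⟩
    obtain ⟨j, hj⟩ := Function.ne_iff.1 hv
    have hj' : v j ≠ 0 := hj
    have h1 := (h g).eq
    rw [mul_vecMulVec, vecMulVec_mul] at h1
    refine ⟨(v ᵥ* ψ g) j / v j, ?_⟩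
    rw [mul_vecMulVec, ← smul_vecMulVec]
    congr 1
    ext i
    have h2 : (ψ g *ᵥ u) i * v j = u i * (v ᵥ* ψ g) j := congrFun (congrFun h1 i) j
    rw [Pi.smul_apply, smul_eq_mul]
    field_simp
    linear_combination h2
  have hfix : ∀ {u v : Fin 3 → K}, (∀ g, Commute (ψ g) (vecMulVec u v)) → ∀ g h : G,
      ψ ⁅g, h⁆ * vecMulVec u v = vecMulVec u v := by
    intro u v hc g h
    obtain ⟨t, ht⟩ := hscal hc g
    obtain ⟨t', ht'⟩ := hscal hc h
    have h1 : ψ (g * h) * vecMulVec u v = ψ (h * g) * vecMulVec u v := by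
      rw [map_mul, map_mul, mul_assoc, mul_assoc, ht, ht', mul_smul_comm, mul_smul_comm, ht, ht',
        smul_comm]
    have h2 : ⁅g, h⁆ * (h * g) = g * h := by
      rw [commutatorElement_def]; group
    have h3 : ψ ⁅g, h⁆ * vecMulVec u v * ψ (h * g) = vecMulVec u v * ψ (h * g) := by
      rw [mul_assoc, ← (hc _).eq, ← mul_assoc, ← map_mul, h2, h1]
    have h4 : ψ (h * g) * ψ (h * g)⁻¹ = 1 := by rw [← map_mul, mul_inv_cancel, map_one]
    have h5 := congrArg (· * ψ (h * g)⁻¹) h3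
    simpa only [mul_assoc, h4, mul_one] using h5
  exact hne <| commute_of_mul_vecMulVec_eq (hdet a b) (hdet c d) hXY'
    (hfix hXv a b) ((hXv _).eq ▸ hfix hXv a b) (hfix hYv a b) ((hYv _).eq ▸ hfix hYv a b)
    (hfix hXv c d) ((hXv _).eq ▸ hfix hXv c d) (hfix hYv c d) ((hYv _).eq ▸ hfix hYv c d)

/-- The product of a free group and a free monoid on two generators does not embed in the monoid of
`3 × 3` matrices over an algebraically closed field. -/
theorem not_injective_freeGroup_prod_freeMonoid {K : Type*} [Field K] [IsAlgClosed K]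
    (φ : FreeGroup (Fin 2) × FreeMonoid (Fin 2) →* Matrix (Fin 3) (Fin 3) K) :
    ¬ Function.Injective φ := by
  intro hφ
  set e := φ 1 with he
  have hee : e * e = e := by rw [he, ← map_mul, one_mul]
  have hel : ∀ x, e * φ x = φ x := fun x => by rw [he, ← map_mul, one_mul]
  have her : ∀ x, φ x * e = φ x := fun x => by rw [he, ← map_mul, mul_one]
  let ψ : FreeGroup (Fin 2) →* Matrix (Fin 3) (Fin 3) K :=
    { toFun := fun g => φ (g, 1) + (1 - e)
      map_one' := by rw [← Prod.one_eq_mk, ← he, add_sub_cancel]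
      map_mul' := fun g h => by
        have hgh : φ (g * h, 1) = φ (g, 1) * φ (h, 1) := by rw [← map_mul, Prod.mk_mul_mk, one_mul]
        simp only [add_mul, mul_add, sub_mul, mul_sub, one_mul, mul_one, hel, her, hee, ← hgh]
        abel }
  have hψ : Function.Injective ψ := fun g h hgh => by
    have := hφ (add_right_cancel (show φ (g, 1) + (1 - e) = φ (h, 1) + (1 - e) from hgh))
    exact congrArg Prod.fst this
  have hcomm : ∀ m g, Commute (ψ g) (φ (1, m)) := fun m g => by
    have hgm : Commute (φ (g, 1)) (φ (1, m)) := Commute.map (by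
      rw [commute_iff_eq, Prod.mk_mul_mk, Prod.mk_mul_mk, mul_one, one_mul, mul_one, one_mul]) φ
    have hem : Commute e (φ (1, m)) := (hel _).trans (her _).symm
    exact hgm.add_left ((Commute.one_left _).sub_left hem)
  have hXY : ¬ Commute (φ (1, FreeMonoid.of 0)) (φ (1, FreeMonoid.of 1)) := fun h => by
    have h' := h.eq
    rw [← map_mul, ← map_mul] at h'
    have := congrArg (fun x => FreeMonoid.toList x.2) (hφ h')
    simp [FreeMonoid.toList_mul, FreeMonoid.toList_of] at this
  have h := commute_map_commutatorElement ψ (hcomm _) (hcomm _) hXY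
    (FreeGroup.of 0) (FreeGroup.of 1) (FreeGroup.of 0) (FreeGroup.of 1)⁻¹
  have h' := h.eq
  rw [← map_mul, ← map_mul] at h'
  have := hψ h'
  revert this
  decide

theorem stmt_19 (d : ℕ) (hd : d ∈ ({1, 2, 3, 7, 11} : Set ℕ)) :
    ¬ ∃ φ : FreeGroup (Fin 2) × FreeMonoid (Fin 2) →*
        Matrix (Fin 3) (Fin 3) (Od d),
      Function.Injective φ := by
  rintro ⟨φ, hφ⟩
  let ι : Od d →+* ℂ := (algebraMap (QuadField d) ℂ).comp
    (algebraMap (NumberField.RingOfIntegers (QuadField d)) (QuadField d))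
  have hι : Function.Injective ι := (algebraMap (QuadField d) ℂ).injective.comp
    NumberField.RingOfIntegers.coe_injective
  refine not_injective_freeGroup_prod_freeMonoid
    ((ι.mapMatrix (m := Fin 3) : _ →* Matrix (Fin 3) (Fin 3) ℂ).comp φ) ?_
  exact (Matrix.map_injective hι).comp hφ
end
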